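/- arXiv:0802.1440 — 3 statements merged into one kernel-verified Lean document; each statement's English description precedes it below -/
import Mathlib

section
/- ∑_{n=0}^{∞} ψ(n + 1/2)/(2n+1)^4 = -(1/96)(3 π^2 ζ(3) + π^4 γ + 93 ζ(5)). -/
open Real Finset

noncomputable def digamma (x : ℝ) : ℝ := deriv (fun y : ℝ => Real.log (Real.Gamma y)) x

open scoped ENNReal
open Filter Topology

/-- The reciprocal of a natural number, in `ℝ≥0∞`. -/
noncomputable def recip (n : ℕ) : ℝ≥0∞ := (n : ℝ≥0∞)⁻¹

/-- The sum of `a⁻ᵖ` over odd `a`. -/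
noncomputable def oddZeta (p : ℕ) : ℝ≥0∞ := ∑' i : ℕ, recip (2 * i + 1) ^ p

/-- The sum of `b⁻ᵖ` over even `b ≥ 2`. -/
noncomputable def evenZeta (p : ℕ) : ℝ≥0∞ := ∑' i : ℕ, recip (2 * i + 2) ^ p

/-- The Tornheim sum of `a⁻ᵖ b⁻ᑫ (a + b)⁻ʳ` over odd `a` and even `b ≥ 2`. -/
noncomputable def oddEvenSum (p q r : ℕ) : ℝ≥0∞ :=
  ∑' (i : ℕ) (j : ℕ), recip (2 * i + 1) ^ p * recip (2 * j + 2) ^ q * recip (2 * i + 2 * j + 3) ^ r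

/-- The Tornheim sum of `a⁻ᵖ b⁻ᑫ (a + b)⁻ʳ` over odd `a` and odd `b`. -/
noncomputable def oddOddSum (p q r : ℕ) : ℝ≥0∞ :=
  ∑' (i : ℕ) (j : ℕ), recip (2 * i + 1) ^ p * recip (2 * j + 1) ^ q * recip (2 * i + 2 * j + 2) ^ r

lemma recip_eq_ofReal {n : ℕ} (hn : 0 < n) : recip n = ENNReal.ofReal (n : ℝ)⁻¹ := by
  rw [recip, ENNReal.ofReal_inv_of_pos (by exact_mod_cast hn), ENNReal.ofReal_natCast]

lemma toReal_recip (n : ℕ) : (recip n).toReal = (n : ℝ)⁻¹ := by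
  simp [recip]

lemma recip_mul_recip {a b c : ℕ} (ha : 0 < a) (hb : 0 < b) (hc : a + b = c) :
    recip a * recip b = recip c * (recip a + recip b) := by
  have ha' : (0 : ℝ) < a := by exact_mod_cast ha
  have hb' : (0 : ℝ) < b := by exact_mod_cast hb
  subst hc
  rw [recip_eq_ofReal ha, recip_eq_ofReal hb, recip_eq_ofReal (by lia : 0 < a + b),
    ← ENNReal.ofReal_add (by positivity) (by positivity), ← ENNReal.ofReal_mul (by positivity),
    ← ENNReal.ofReal_mul (by positivity)]
  congr 1
  push_cast
  field_simp
  ring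

lemma oddEvenSum_succ_succ (p q r : ℕ) :
    oddEvenSum (p + 1) (q + 1) r = oddEvenSum p (q + 1) (r + 1) + oddEvenSum (p + 1) q (r + 1) := by
  simp only [oddEvenSum, ← ENNReal.tsum_add]
  refine tsum_congr fun i => tsum_congr fun j => ?_
  have h := recip_mul_recip (a := 2 * i + 1) (b := 2 * j + 2) (c := 2 * i + 2 * j + 3)
    (by lia) (by lia) (by lia)
  calc _ = recip (2 * i + 1) ^ p * recip (2 * j + 2) ^ q * recip (2 * i + 2 * j + 3) ^ r *
        (recip (2 * i + 1) * recip (2 * j + 2)) := by ring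
    _ = _ := by rw [h]; ring

lemma oddOddSum_succ_succ (p q r : ℕ) :
    oddOddSum (p + 1) (q + 1) r = oddOddSum p (q + 1) (r + 1) + oddOddSum (p + 1) q (r + 1) := by
  simp only [oddOddSum, ← ENNReal.tsum_add]
  refine tsum_congr fun i => tsum_congr fun j => ?_
  have h := recip_mul_recip (a := 2 * i + 1) (b := 2 * j + 1) (c := 2 * i + 2 * j + 2)
    (by lia) (by lia) (by lia)
  calc _ = recip (2 * i + 1) ^ p * recip (2 * j + 1) ^ q * recip (2 * i + 2 * j + 2) ^ r *
        (recip (2 * i + 1) * recip (2 * j + 1)) := by ring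
    _ = _ := by rw [h]; ring

lemma oddOddSum_comm (p q r : ℕ) : oddOddSum p q r = oddOddSum q p r := by
  rw [oddOddSum, ENNReal.tsum_comm]
  refine tsum_congr fun i => tsum_congr fun j => ?_
  rw [show 2 * j + 2 * i + 2 = 2 * i + 2 * j + 2 by ring]
  ring

lemma oddEvenSum_zero_right (p q : ℕ) : oddEvenSum p q 0 = oddZeta p * evenZeta q := by
  simp only [oddEvenSum, pow_zero, mul_one, ENNReal.tsum_mul_left, ENNReal.tsum_mul_right]
  rfl

lemma oddOddSum_zero_right (p q : ℕ) : oddOddSum p q 0 = oddZeta p * oddZeta q := by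
  simp only [oddOddSum, pow_zero, mul_one, ENNReal.tsum_mul_left, ENNReal.tsum_mul_right]
  rfl

lemma tsum_sum_range (f : ℕ → ℕ → ℝ≥0∞) :
    ∑' i, ∑ k ∈ range i, f i k = ∑' (k) (j), f (k + j + 1) k := by
  have h (i : ℕ) : ∑ k ∈ range i, f i k = ∑' k, if k < i then f i k else 0 := by
    rw [tsum_eq_sum (s := range i) (by simp +contextual)]
    exact sum_congr rfl fun k hk => by rw [if_pos (mem_range.1 hk)]
  simp only [h]
  rw [ENNReal.tsum_comm]
  refine tsum_congr fun k => ?_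
  rw [← Summable.sum_add_tsum_nat_add' (k := k + 1) ENNReal.summable, sum_eq_zero, zero_add]
  · refine tsum_congr fun j => ?_
    rw [if_pos (by lia), show j + (k + 1) = k + j + 1 by ring]
  · intro i hi
    rw [if_neg (by simp at hi; lia)]

lemma tsum_sum_range_succ (f : ℕ → ℕ → ℝ≥0∞) :
    ∑' i, ∑ k ∈ range (i + 1), f i k = ∑' (k) (j), f (k + j) k := by
  have h := tsum_sum_range fun i k => f (i - 1) k
  rw [tsum_eq_zero_add' ENNReal.summable] at h
  simpa using h

lemma tsum_tsum_eq_add (f : ℕ → ℕ → ℝ≥0∞) :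
    ∑' (i) (k), f i k = ∑' (k) (j), f (k + j + 1) k + ∑' (i) (j), f i (i + j) := by
  rw [← tsum_sum_range, ← ENNReal.tsum_add]
  refine tsum_congr fun i => ?_
  rw [← Summable.sum_add_tsum_nat_add' (k := i) ENNReal.summable]
  simp only [add_comm]

lemma oddZeta_mul_oddZeta (p r : ℕ) :
    oddZeta p * oddZeta r = oddEvenSum p 0 r + oddEvenSum r 0 p + oddZeta (p + r) := by
  have h (i : ℕ) := tsum_eq_zero_add' (f := fun j => recip (2 * i + 1) ^ p *
    recip (2 * (i + j) + 1) ^ r * recip (2 * i + 2 * (i + j) + 2) ^ 0) ENNReal.summable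
  calc oddZeta p * oddZeta r = oddEvenSum r 0 p + (oddZeta (p + r) + oddEvenSum p 0 r) := by
        rw [← oddOddSum_zero_right, oddOddSum, tsum_tsum_eq_add]
        congr 1
        · refine tsum_congr fun i => tsum_congr fun j => ?_
          rw [show 2 * (i + j + 1) + 1 = 2 * i + 2 * j + 3 by ring]
          ring
        · simp only [h, ENNReal.tsum_add]
          congr 1
          · refine tsum_congr fun i => ?_
            rw [add_zero]
            ring
          · refine tsum_congr fun i => tsum_congr fun j => ?_
            rw [show 2 * (i + (j + 1)) + 1 = 2 * i + 2 * j + 3 by ring]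
            ring
    _ = _ := by ring

lemma oddZeta_mul_evenZeta (r q : ℕ) :
    oddZeta r * evenZeta q = oddEvenSum 0 q r + oddOddSum r 0 q := by
  rw [← oddEvenSum_zero_right, oddEvenSum, tsum_tsum_eq_add, oddEvenSum, oddOddSum]
  congr 1
  · rw [ENNReal.tsum_comm]
    refine tsum_congr fun i => tsum_congr fun j => ?_
    rw [show 2 * (j + i + 1) + 1 = 2 * i + 2 * j + 3 by ring]
    ring
  · refine tsum_congr fun i => tsum_congr fun j => ?_
    rw [show 2 * (i + j) + 2 = 2 * i + 2 * j + 2 by ring]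
    ring

lemma hasSum_sub_of_tendsto_zero {f : ℕ → ℝ} (hf : Antitone f) (h0 : Tendsto f atTop (𝓝 0))
    (N : ℕ) : HasSum (fun n => f n - f (n + N)) (∑ n ∈ range N, f n) := by
  rw [hasSum_iff_tendsto_nat_of_nonneg fun n => sub_nonneg.2 (hf (by lia))]
  have h (M : ℕ) : ∑ n ∈ range M, (f n - f (n + N)) =
      ∑ n ∈ range N, f n - ∑ n ∈ range N, f (M + n) := by
    have h1 := sum_range_add f M N
    have h2 := sum_range_add f N M
    rw [add_comm N M] at h2
    simp only [sum_sub_distrib, add_comm _ N]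
    linarith
  simp only [h]
  have h2 : Tendsto (fun M => ∑ n ∈ range N, f (M + n)) atTop (𝓝 (∑ n ∈ range N, (0 : ℝ))) :=
    tendsto_finsetSum _ fun n _ => h0.comp (tendsto_add_atTop_nat n)
  simpa using h2.const_sub (∑ n ∈ range N, f n)

lemma antitone_inv_arith (s : ℕ) {t : ℕ} (ht : 0 < t) :
    Antitone fun n : ℕ => ((s * n + t : ℕ) : ℝ)⁻¹ := by
  intro m n hmn
  have : s * m ≤ s * n := Nat.mul_le_mul_left s hmn
  refine inv_anti₀ (by exact_mod_cast (by lia : 0 < s * m + t)) ?_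
  exact_mod_cast (by lia : s * m + t ≤ s * n + t)

lemma tendsto_inv_arith {s : ℕ} (hs : 0 < s) (t : ℕ) :
    Tendsto (fun n : ℕ => ((s * n + t : ℕ) : ℝ)⁻¹) atTop (𝓝 0) := by
  refine tendsto_inv_atTop_zero.comp (tendsto_natCast_atTop_atTop.comp ?_)
  exact tendsto_atTop_mono (fun n => (by nlinarith : n ≤ s * n + t)) tendsto_id

lemma tsum_recip_mul_recip {s t N : ℕ} (hs : 0 < s) (ht : 0 < t) (hN : 0 < N) :
    ∑' n : ℕ, recip (s * n + t) * recip (s * n + t + s * N) =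
      recip (s * N) * ∑ n ∈ range N, recip (s * n + t) := by
  have hsN : 0 < s * N := by positivity
  have hsum := (hasSum_sub_of_tendsto_zero (antitone_inv_arith s ht)
    (tendsto_inv_arith hs t) N).mul_left ((s * N : ℕ) : ℝ)⁻¹
  have hterm (n : ℕ) : recip (s * n + t) * recip (s * n + t + s * N) =
      ENNReal.ofReal (((s * N : ℕ) : ℝ)⁻¹ *
        (((s * n + t : ℕ) : ℝ)⁻¹ - ((s * (n + N) + t : ℕ) : ℝ)⁻¹)) := by
    rw [recip_eq_ofReal (by lia), recip_eq_ofReal (by lia), ← ENNReal.ofReal_mul (by positivity)]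
    congr 1
    have h1 : (0 : ℝ) < (s * n + t : ℕ) := by exact_mod_cast (by lia : 0 < s * n + t)
    have h2 : (0 : ℝ) < (s * N : ℕ) := by exact_mod_cast hsN
    rw [show s * (n + N) + t = s * n + t + s * N by ring, Nat.cast_add (s * n + t)]
    field_simp
    ring
  simp only [hterm]
  rw [← ENNReal.ofReal_tsum_of_nonneg (fun n => mul_nonneg (by positivity)
    (sub_nonneg.2 (antitone_inv_arith s ht (by lia)))) hsum.summable, hsum.tsum_eq,
    ENNReal.ofReal_mul (by positivity), ENNReal.ofReal_sum_of_nonneg (fun _ _ => by positivity),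
    recip_eq_ofReal hsN]
  congr 1
  exact sum_congr rfl fun n _ => (recip_eq_ofReal (by lia)).symm

lemma oddEvenSum_one_three_one : oddEvenSum 1 3 1 = oddOddSum 1 0 4 := by
  rw [oddEvenSum, ENNReal.tsum_comm, oddOddSum]
  have h (j : ℕ) : ∑' i : ℕ, recip (2 * i + 1) ^ 1 * recip (2 * j + 2) ^ 3 *
      recip (2 * i + 2 * j + 3) ^ 1 =
      ∑ i ∈ range (j + 1), recip (2 * j + 2) ^ 4 * recip (2 * i + 1) := by
    rw [← mul_sum]
    have := tsum_recip_mul_recip (s := 2) (t := 1) (N := j + 1) (by lia) (by lia) (by lia)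
    calc _ = ∑' i : ℕ, recip (2 * j + 2) ^ 3 *
          (recip (2 * i + 1) * recip (2 * i + 1 + 2 * (j + 1))) := by
          refine tsum_congr fun i => ?_
          rw [show 2 * i + 1 + 2 * (j + 1) = 2 * i + 2 * j + 3 by ring]
          ring
      _ = _ := by
          rw [ENNReal.tsum_mul_left, this, show 2 * (j + 1) = 2 * j + 2 by ring]
          ring
  simp only [h]
  rw [tsum_sum_range_succ]
  refine tsum_congr fun i => tsum_congr fun j => ?_
  rw [show 2 * (i + j) + 2 = 2 * i + 2 * j + 2 by ring]
  ring

lemma oddEvenSum_add_oddOddSum_three_one_one :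
    oddEvenSum 3 1 1 + oddOddSum 3 1 1 = oddZeta 5 + oddEvenSum 1 1 3 := by
  have hsum (i : ℕ) : ∑ n ∈ range (2 * i + 1), recip (1 * n + 1) =
      recip (2 * i + 1) + ∑ k ∈ range i, (recip (2 * k + 1) + recip (2 * k + 2)) := by
    induction i with
    | zero => simp
    | succ i ih =>
      rw [show 2 * (i + 1) + 1 = 2 * i + 1 + 1 + 1 by ring, sum_range_succ, sum_range_succ, ih,
        sum_range_succ]
      simp only [one_mul, show 2 * i + 1 + 1 = 2 * i + 2 by ring]
      ring
  have h (i : ℕ) :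
      ∑' j : ℕ, recip (2 * i + 1) ^ 3 * recip (2 * j + 2) ^ 1 * recip (2 * i + 2 * j + 3) ^ 1 +
      ∑' j : ℕ, recip (2 * i + 1) ^ 3 * recip (2 * j + 1) ^ 1 * recip (2 * i + 2 * j + 2) ^ 1 =
      recip (2 * i + 1) ^ 5 + ∑ k ∈ range i,
        recip (2 * i + 1) ^ 4 * (recip (2 * k + 1) + recip (2 * k + 2)) := by
    have ht := tsum_recip_mul_recip (s := 1) (t := 1) (N := 2 * i + 1) (by lia) (by lia) (by lia)
    rw [← tsum_even_add_odd ENNReal.summable ENNReal.summable, hsum i, one_mul] at ht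
    calc _ = recip (2 * i + 1) ^ 3 *
          (∑' k, recip (1 * (2 * k) + 1) * recip (1 * (2 * k) + 1 + (2 * i + 1)) +
          ∑' k, recip (1 * (2 * k + 1) + 1) * recip (1 * (2 * k + 1) + 1 + (2 * i + 1))) := by
          rw [mul_add, ← ENNReal.tsum_mul_left, ← ENNReal.tsum_mul_left, add_comm]
          congr 1
          · refine tsum_congr fun j => ?_
            rw [one_mul, show 2 * j + 1 + (2 * i + 1) = 2 * i + 2 * j + 2 by ring]
            ring
          · refine tsum_congr fun j => ?_
            rw [one_mul, show 2 * j + 1 + 1 + (2 * i + 1) = 2 * i + 2 * j + 3 by ring]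
            ring
      _ = _ := by
          rw [ht, ← mul_sum]
          ring
  rw [oddEvenSum, oddOddSum, ← ENNReal.tsum_add]
  simp only [h]
  rw [ENNReal.tsum_add, tsum_sum_range, oddZeta]
  congr 1
  rw [oddEvenSum_succ_succ 0 0 3, oddEvenSum, oddEvenSum, ENNReal.tsum_comm (f := fun i j =>
    recip (2 * i + 1) ^ 0 * recip (2 * j + 2) ^ (0 + 1) * recip (2 * i + 2 * j + 3) ^ (3 + 1)),
    ← ENNReal.tsum_add]
  refine tsum_congr fun i => ?_
  rw [← ENNReal.tsum_add]
  refine tsum_congr fun j => ?_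
  rw [show 2 * (i + j + 1) + 1 = 2 * i + 2 * j + 3 by ring,
    show 2 * j + 2 * i + 3 = 2 * i + 2 * j + 3 by ring]
  ring

lemma tsum_recip_pow {k : ℕ} (hk : 1 < k) :
    ∑' n : ℕ, recip (n + 1) ^ k = ENNReal.ofReal (∑' n : ℕ, 1 / (n : ℝ) ^ k) := by
  have hs : Summable fun n : ℕ => 1 / (n : ℝ) ^ k := Real.summable_one_div_nat_pow.2 hk
  rw [hs.tsum_eq_zero_add, ENNReal.ofReal_add (by positivity) (tsum_nonneg fun n => by positivity),
    ENNReal.ofReal_tsum_of_nonneg (fun n => by positivity) ((summable_nat_add_iff 1).2 hs)]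
  simp only [Nat.cast_zero, zero_pow (by lia : k ≠ 0), div_zero, ENNReal.ofReal_zero, zero_add]
  refine tsum_congr fun n => ?_
  rw [recip_eq_ofReal (by lia), ← ENNReal.ofReal_pow (by positivity), one_div, inv_pow]

lemma oddZeta_add_evenZeta {k : ℕ} (hk : 1 < k) :
    oddZeta k + evenZeta k = ENNReal.ofReal (∑' n : ℕ, 1 / (n : ℝ) ^ k) := by
  rw [← tsum_recip_pow hk, ← tsum_even_add_odd ENNReal.summable ENNReal.summable]
  rfl

lemma evenZeta_eq {k : ℕ} (hk : 1 < k) :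
    evenZeta k = recip 2 ^ k * ENNReal.ofReal (∑' n : ℕ, 1 / (n : ℝ) ^ k) := by
  rw [← tsum_recip_pow hk, ← ENNReal.tsum_mul_left]
  refine tsum_congr fun n => ?_
  rw [← mul_pow, recip_eq_ofReal (by lia), recip_eq_ofReal (by lia), recip_eq_ofReal (by lia),
    ← ENNReal.ofReal_mul (by positivity), ← mul_inv]
  push_cast
  ring_nf

lemma oddZeta_ne_top {k : ℕ} (hk : 1 < k) : oddZeta k ≠ ⊤ :=
  ((le_add_right le_rfl).trans_lt
    ((oddZeta_add_evenZeta hk).trans_lt ENNReal.ofReal_lt_top)).ne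

lemma evenZeta_ne_top {k : ℕ} (hk : 1 < k) : evenZeta k ≠ ⊤ :=
  ((le_add_left le_rfl).trans_lt
    ((oddZeta_add_evenZeta hk).trans_lt ENNReal.ofReal_lt_top)).ne

lemma toReal_evenZeta {k : ℕ} (hk : 1 < k) :
    (evenZeta k).toReal = (∑' n : ℕ, 1 / (n : ℝ) ^ k) / 2 ^ k := by
  rw [evenZeta_eq hk, ENNReal.toReal_mul, ENNReal.toReal_pow, toReal_recip,
    ENNReal.toReal_ofReal (tsum_nonneg fun n => by positivity), Nat.cast_ofNat, inv_pow,
    inv_mul_eq_div]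

lemma toReal_oddZeta {k : ℕ} (hk : 1 < k) :
    (oddZeta k).toReal = (1 - 1 / 2 ^ k) * ∑' n : ℕ, 1 / (n : ℝ) ^ k := by
  have h := congrArg ENNReal.toReal (oddZeta_add_evenZeta hk)
  rw [ENNReal.toReal_add (oddZeta_ne_top hk) (evenZeta_ne_top hk), toReal_evenZeta hk,
    ENNReal.toReal_ofReal (tsum_nonneg fun n => by positivity)] at h
  rw [eq_sub_of_add_eq h]
  ring

lemma toReal_eq_add {a b c : ℝ≥0∞} (h : a = b + c) (ha : a ≠ ⊤) :
    b ≠ ⊤ ∧ c ≠ ⊤ ∧ a.toReal = b.toReal + c.toReal := by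
  subst h
  obtain ⟨hb, hc⟩ := ENNReal.add_ne_top.1 ha
  exact ⟨hb, hc, ENNReal.toReal_add hb hc⟩

lemma oddEvenSum_three_one_one :
    oddEvenSum 3 1 1 ≠ ⊤ ∧ 2 * (oddEvenSum 3 1 1).toReal =
      (oddZeta 5).toReal - 2 * ((oddZeta 2).toReal * (evenZeta 3).toReal) := by
  have o2 := oddZeta_ne_top (k := 2) (by simp)
  have o3 := oddZeta_ne_top (k := 3) (by simp)
  have e2 := evenZeta_ne_top (k := 2) (by simp)
  have e3 := evenZeta_ne_top (k := 3) (by simp)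
  have t320 : oddEvenSum 3 2 0 ≠ ⊤ := oddEvenSum_zero_right 3 2 ▸ ENNReal.mul_ne_top o3 e2
  have t230 : oddEvenSum 2 3 0 ≠ ⊤ := oddEvenSum_zero_right 2 3 ▸ ENNReal.mul_ne_top o2 e3
  have u320 : oddOddSum 3 2 0 ≠ ⊤ := oddOddSum_zero_right 3 2 ▸ ENNReal.mul_ne_top o3 o2
  have v320 := congrArg ENNReal.toReal (oddEvenSum_zero_right 3 2)
  have v230 := congrArg ENNReal.toReal (oddEvenSum_zero_right 2 3)
  have w320 := congrArg ENNReal.toReal (oddOddSum_zero_right 3 2)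
  obtain ⟨t221, t311, r320⟩ := toReal_eq_add (oddEvenSum_succ_succ 2 1 0) t320
  obtain ⟨t131, -, r230⟩ := toReal_eq_add (oddEvenSum_succ_succ 1 2 0) t230
  obtain ⟨t122, t212, r221⟩ := toReal_eq_add (oddEvenSum_succ_succ 1 1 1) t221
  obtain ⟨-, t302, r311⟩ := toReal_eq_add (oddEvenSum_succ_succ 2 0 1) t311
  obtain ⟨t113, t203, r212⟩ := toReal_eq_add (oddEvenSum_succ_succ 1 0 2) t212
  obtain ⟨t023, -, r122⟩ := toReal_eq_add (oddEvenSum_succ_succ 0 1 2) t122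
  obtain ⟨t032, -, r131⟩ := toReal_eq_add (oddEvenSum_succ_succ 0 2 1) t131
  obtain ⟨u221, u311, s320⟩ := toReal_eq_add (oddOddSum_succ_succ 2 1 0) u320
  obtain ⟨u122, u212, s221⟩ := toReal_eq_add (oddOddSum_succ_succ 1 1 1) u221
  obtain ⟨u113, u203, s212⟩ := toReal_eq_add (oddOddSum_succ_succ 1 0 2) u212
  obtain ⟨-, u302, s311⟩ := toReal_eq_add (oddOddSum_succ_succ 2 0 1) u311
  obtain ⟨u014, u104, s113⟩ := toReal_eq_add (oddOddSum_succ_succ 0 0 3) u113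
  have c122 := congrArg ENNReal.toReal (oddOddSum_comm 1 2 2)
  have c014 := congrArg ENNReal.toReal (oddOddSum_comm 0 1 4)
  obtain ⟨m1, o5, p1⟩ := toReal_eq_add (oddZeta_mul_oddZeta 3 2) (ENNReal.mul_ne_top o3 o2)
  obtain ⟨-, -, p2⟩ := toReal_eq_add rfl m1
  obtain ⟨-, -, p3⟩ := toReal_eq_add (oddZeta_mul_evenZeta 3 2) (ENNReal.mul_ne_top o3 e2)
  obtain ⟨-, -, p4⟩ := toReal_eq_add (oddZeta_mul_evenZeta 2 3) (ENNReal.mul_ne_top o2 e3)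
  have q1 := congrArg ENNReal.toReal oddEvenSum_add_oddOddSum_three_one_one
  rw [ENNReal.toReal_add t311 u311, ENNReal.toReal_add o5 t113] at q1
  have q2 := congrArg ENNReal.toReal oddEvenSum_one_three_one
  simp only [ENNReal.toReal_mul, Nat.reduceAdd, zero_add] at *
  refine ⟨t311, ?_⟩
  linarith

lemma hasSum_inv_even_sub_inv_odd :
    HasSum (fun j : ℕ => (2 * (j : ℝ) + 2)⁻¹ - (2 * (j : ℝ) + 3)⁻¹) (1 - Real.log 2) := by
  rw [hasSum_iff_tendsto_nat_of_nonneg fun j => sub_nonneg.2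
    (inv_anti₀ (by positivity) (by linarith))]
  have hpart (M : ℕ) : ∑ j ∈ range M, ((2 * (j : ℝ) + 2)⁻¹ - (2 * (j : ℝ) + 3)⁻¹) =
      1 + (harmonic M : ℝ) - harmonic (2 * M + 1) := by
    induction M with
    | zero => simp [harmonic_succ]
    | succ M ih =>
      rw [sum_range_succ, ih, show 2 * (M + 1) + 1 = 2 * M + 1 + 1 + 1 by ring,
        harmonic_succ M, harmonic_succ (2 * M + 1 + 1), harmonic_succ (2 * M + 1)]
      push_cast
      field_simp
      ring
  have h1 := Real.tendsto_harmonic_sub_log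
  have h2 : Tendsto (fun M : ℕ => 2 * M + 1) atTop atTop :=
    tendsto_atTop_mono (fun M => (by lia : M ≤ 2 * M + 1)) tendsto_id
  have h3 : Tendsto (fun M : ℕ => Real.log (2 + 1 / (M : ℝ))) atTop (𝓝 (Real.log 2)) := by
    have := (tendsto_one_div_atTop_nhds_zero_nat (𝕜 := ℝ)).const_add 2
    rw [add_zero] at this
    exact this.log two_ne_zero
  have h4 := ((h1.sub (h1.comp h2)).const_add 1).sub h3
  rw [sub_self, add_zero] at h4
  refine h4.congr' ?_
  filter_upwards [eventually_gt_atTop 0] with M hM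
  have hM' : (0 : ℝ) < M := by exact_mod_cast hM
  rw [hpart, show 2 + 1 / (M : ℝ) = (2 * M + 1) / M by field_simp,
    Real.log_div (by positivity) hM'.ne']
  simp only [Function.comp_apply]
  push_cast
  ring

lemma hasSum_inv_even_sub_inv_odd_add (i : ℕ) :
    HasSum (fun j : ℕ => (2 * (j : ℝ) + 2)⁻¹ - (2 * (i : ℝ) + 2 * j + 3)⁻¹)
      (∑ k ∈ range (i + 1), (2 * (k : ℝ) + 1)⁻¹ - Real.log 2) := by
  have h := hasSum_inv_even_sub_inv_odd.add (hasSum_sub_of_tendsto_zero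
    (antitone_inv_arith 2 (t := 3) (by simp)) (tendsto_inv_arith (s := 2) (by simp) 3) i)
  convert! h using 1
  · ext j
    push_cast
    ring_nf
  · rw [sum_range_succ']
    push_cast
    ring_nf

lemma toReal_tsum_recip (i : ℕ) :
    (∑' j : ℕ, recip (2 * i + 1) ^ 3 * recip (2 * j + 2) ^ 1 * recip (2 * i + 2 * j + 3) ^ 1).toReal
      = ((2 * (i : ℝ) + 1)⁻¹) ^ 4 *
        (∑ k ∈ range (i + 1), (2 * (k : ℝ) + 1)⁻¹ - Real.log 2) := by
  rw [ENNReal.tsum_toReal_eq fun j => by simp [recip, ENNReal.mul_eq_top],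
    ← ((hasSum_inv_even_sub_inv_odd_add i).mul_left _).tsum_eq]
  refine tsum_congr fun j => ?_
  simp only [ENNReal.toReal_mul, ENNReal.toReal_pow, toReal_recip]
  push_cast
  field_simp
  ring

lemma digamma_add_one {x : ℝ} (hx : 0 < x) : digamma (x + 1) = digamma x + x⁻¹ := by
  have hd : DifferentiableAt ℝ (fun y => Real.log (Real.Gamma y)) x :=
    (Real.differentiableAt_Gamma fun m => by
      have : (0 : ℝ) ≤ m := m.cast_nonneg
      linarith).log (Real.Gamma_pos_of_pos hx).ne'
  have h : (fun y => Real.log (Real.Gamma (y + 1))) =ᶠ[𝓝 x]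
      fun y => Real.log (Real.Gamma y) + Real.log y := by
    filter_upwards [lt_mem_nhds hx] with y hy
    rw [Real.Gamma_add_one hy.ne', Real.log_mul hy.ne' (Real.Gamma_pos_of_pos hy).ne', add_comm]
  rw [digamma, ← deriv_comp_add_const, h.deriv_eq,
    (hd.hasDerivAt.fun_add (Real.hasDerivAt_log hx.ne')).deriv, digamma]

lemma digamma_one_half :
    digamma (1 / 2) = -Real.eulerMascheroniConstant - 2 * Real.log 2 := by
  rw [digamma, (Real.hasDerivAt_Gamma_one_half.log (Real.Gamma_pos_of_pos (by simp)).ne').deriv,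
    Real.Gamma_one_half_eq]
  have : √π ≠ 0 := (Real.sqrt_pos.2 Real.pi_pos).ne'
  field_simp
  ring

lemma digamma_nat_add_one_half (n : ℕ) :
    digamma ((n : ℝ) + 1 / 2) = -Real.eulerMascheroniConstant - 2 * Real.log 2 +
      2 * ∑ k ∈ range n, (2 * (k : ℝ) + 1)⁻¹ := by
  induction n with
  | zero => simpa using digamma_one_half
  | succ n ih =>
    rw [sum_range_succ, show ((n + 1 : ℕ) : ℝ) + 1 / 2 = n + 1 / 2 + 1 by push_cast; ring,
      digamma_add_one (by positivity), ih]
    field_simp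
    ring

lemma hasSum_oddZeta {k : ℕ} (hk : 1 < k) :
    HasSum (fun n : ℕ => ((2 * (n : ℝ) + 1)⁻¹) ^ k) (oddZeta k).toReal := by
  convert! ENNReal.hasSum_toReal (oddZeta_ne_top hk) using 2 with n
  · rw [ENNReal.toReal_pow, toReal_recip]
    push_cast
    rfl
  · exact ENNReal.tsum_toReal_eq fun n => ENNReal.ne_top_of_tsum_ne_top (oddZeta_ne_top hk) n

lemma hasSum_digamma :
    HasSum (fun n : ℕ => digamma ((n : ℝ) + 1 / 2) / (2 * (n : ℝ) + 1) ^ 4)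
      (-Real.eulerMascheroniConstant * (oddZeta 4).toReal +
        2 * (oddEvenSum 3 1 1).toReal - 2 * (oddZeta 5).toReal) := by
  have h := (((hasSum_oddZeta (k := 4) (by simp)).mul_left (-Real.eulerMascheroniConstant)).add
    ((ENNReal.hasSum_toReal oddEvenSum_three_one_one.1).mul_left 2)).sub
    ((hasSum_oddZeta (k := 5) (by simp)).mul_left 2)
  rw [← ENNReal.tsum_toReal_eq (ENNReal.ne_top_of_tsum_ne_top oddEvenSum_three_one_one.1)] at h
  convert! h using 2 with n
  rw [toReal_tsum_recip, digamma_nat_add_one_half, sum_range_succ]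
  field_simp
  ring

lemma riemannZeta_eq_ofReal_tsum {k : ℕ} (hk : 1 < k) :
    riemannZeta k = ((∑' n : ℕ, 1 / (n : ℝ) ^ k : ℝ) : ℂ) := by
  rw [zeta_nat_eq_tsum_of_gt_one hk]
  push_cast
  rfl

theorem stmt_8 :
    ((∑' n : ℕ, digamma ((n : ℝ) + 1/2) / (2 * (n : ℝ) + 1) ^ 4 : ℝ) : ℂ) =
      -(1/96) * (3 * (Real.pi : ℂ) ^ 2 * riemannZeta 3 +
        (Real.pi : ℂ) ^ 4 * (Real.eulerMascheroniConstant : ℂ) + 93 * riemannZeta 5) := by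
  have h3 := riemannZeta_eq_ofReal_tsum (k := 3) (by simp)
  have h5 := riemannZeta_eq_ofReal_tsum (k := 5) (by simp)
  rw [Nat.cast_ofNat] at h3 h5
  rw [h3, h5, hasSum_digamma.tsum_eq, oddEvenSum_three_one_one.2, toReal_oddZeta (by simp),
    toReal_oddZeta (by simp), toReal_oddZeta (by simp), toReal_evenZeta (by simp),
    hasSum_zeta_two.tsum_eq, hasSum_zeta_four.tsum_eq]
  push_cast
  ring
end

section
/- ∫_0^1 x^2 log Γ(x) dx = ζ(3)/(4π^2) + (1/6) log(2π) - log A, where log A = 1/12 - ζ'(-1). -/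
noncomputable def logA : ℝ := 1/12 - (deriv riemannZeta (-1)).re

open Set Filter Topology MeasureTheory intervalIntegral

/-- The fourth Bernoulli polynomial. -/
noncomputable def bernoulliFour (x : ℝ) : ℝ := x ^ 4 - 2 * x ^ 3 + x ^ 2 - 1 / 30

/-- The periodized fourth Bernoulli polynomial, restricted to `(1, ∞)`. -/
noncomputable def bernoulliFourKernel : ℝ → ℂ :=
  (Ioi 1).indicator fun t ↦ (bernoulliFour (Int.fract t) : ℂ)

/-- The remainder integral `∫ t in (1, ∞), t ^ (-s - 4) * B₄(fract t)` of the Euler–Maclaurin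
formula for `ζ(s)`. -/
noncomputable def eulerMaclaurinRemainder (s : ℂ) : ℂ := mellin bernoulliFourKernel (-s - 3)

lemma continuous_bernoulliFour : Continuous bernoulliFour := by
  unfold bernoulliFour; fun_prop

lemma norm_bernoulliFourKernel_le (t : ℝ) : ‖bernoulliFourKernel t‖ ≤ 4 := by
  unfold bernoulliFourKernel indicator
  split_ifs
  · rw [Complex.norm_real, Real.norm_eq_abs, bernoulliFour, abs_le]
    have h0 := Int.fract_nonneg t
    have h1 := (Int.fract_lt_one t).le
    generalize Int.fract t = x at *
    have h2 : x ^ 2 ≤ 1 := pow_le_one₀ h0 h1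
    have h3 : x ^ 3 ≤ 1 := pow_le_one₀ h0 h1
    have h4 : x ^ 4 ≤ 1 := pow_le_one₀ h0 h1
    have h2' : 0 ≤ x ^ 2 := by positivity
    have h3' : 0 ≤ x ^ 3 := by positivity
    have h4' : 0 ≤ x ^ 4 := by positivity
    constructor <;> linarith
  · simp

lemma locallyIntegrableOn_bernoulliFourKernel :
    LocallyIntegrableOn bernoulliFourKernel (Ioi 0) := by
  refine LocallyIntegrable.locallyIntegrableOn ?_ _
  refine (locallyIntegrable_const (4 : ℝ)).mono ?_ ?_
  · have : Measurable bernoulliFourKernel := by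
      refine Measurable.indicator ?_ measurableSet_Ioi
      exact Complex.measurable_ofReal.comp
        (continuous_bernoulliFour.measurable.comp measurable_fract)
    exact this.aestronglyMeasurable
  · filter_upwards with t
    simpa using norm_bernoulliFourKernel_le t

lemma bernoulliFourKernel_isBigO_atTop :
    bernoulliFourKernel =O[atTop] (fun t : ℝ ↦ t ^ (-(0 : ℝ))) := by
  refine Asymptotics.IsBigO.of_bound 4 (Eventually.of_forall fun t ↦ ?_)
  simpa using norm_bernoulliFourKernel_le t

lemma bernoulliFourKernel_isBigO_nhdsGT (b : ℝ) :
    bernoulliFourKernel =O[𝓝[>] 0] (fun t : ℝ ↦ t ^ (-b)) := by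
  refine Asymptotics.IsBigO.of_bound 1 ?_
  filter_upwards [Ioo_mem_nhdsGT (zero_lt_one (α := ℝ))] with t ht
  have : t ∉ Ioi (1 : ℝ) := by simpa using ht.2.le
  simp only [bernoulliFourKernel, indicator_of_notMem this, norm_zero]
  positivity

lemma differentiableAt_eulerMaclaurinRemainder {s : ℂ} (hs : -3 < s.re) :
    DifferentiableAt ℂ eulerMaclaurinRemainder s := by
  have h : DifferentiableAt ℂ (mellin bernoulliFourKernel) (-s - 3) :=
    mellin_differentiableAt_of_isBigO_rpow (a := 0) (b := (-s - 3).re - 1)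
      locallyIntegrableOn_bernoulliFourKernel bernoulliFourKernel_isBigO_atTop
      (by simp; linarith) (bernoulliFourKernel_isBigO_nhdsGT _) (by simp)
  exact DifferentiableAt.comp s (f := fun s : ℂ ↦ -s - 3) h (by fun_prop)

lemma tendsto_sum_integral_bernoulliFour {s : ℂ} (hs : -3 < s.re) :
    Tendsto (fun N : ℕ ↦ ∑ m ∈ Finset.range N, ∫ t in (m + 1 : ℝ)..(m + 1 + 1),
      (t : ℂ) ^ (-s - 4) * (bernoulliFour (t - (m + 1)) : ℂ)) atTop
      (𝓝 (eulerMaclaurinRemainder s)) := by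
  have hconv : MellinConvergent bernoulliFourKernel (-s - 3) :=
    mellinConvergent_of_isBigO_rpow (a := 0) (b := (-s - 3).re - 1)
      locallyIntegrableOn_bernoulliFourKernel bernoulliFourKernel_isBigO_atTop
      (by simp; linarith) (bernoulliFourKernel_isBigO_nhdsGT _) (by simp)
  set F : ℝ → ℂ := fun t ↦ (t : ℂ) ^ (-s - 3 - 1) • bernoulliFourKernel t with hF
  have hint : IntegrableOn F (Ioi 0) := hconv
  have hint1 : IntegrableOn F (Ioi 1) := hint.mono_set (Ioi_subset_Ioi zero_le_one)
  have hval : eulerMaclaurinRemainder s = ∫ t in Ioi 1, F t := by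
    rw [eulerMaclaurinRemainder, mellin]
    refine (setIntegral_eq_of_subset_of_forall_sdiff_eq_zero measurableSet_Ioi
      (Ioi_subset_Ioi zero_le_one) fun t ht ↦ ?_)
    simp [bernoulliFourKernel, indicator_of_notMem ht.2]
  have hlim := intervalIntegral_tendsto_integral_Ioi 1 hint1
    (tendsto_atTop_add_const_right atTop (1 : ℝ) (tendsto_natCast_atTop_atTop (R := ℝ)))
  rw [hval]
  refine hlim.congr fun N ↦ ?_
  have hadj := sum_integral_adjacent_intervals (f := F) (μ := volume)
    (a := fun k : ℕ ↦ (k + 1 : ℝ)) (n := N) (fun k _ ↦ by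
      rw [intervalIntegrable_iff_integrableOn_Ioc_of_le (by simp)]
      exact hint1.mono_set fun t ht ↦ lt_of_le_of_lt (by simp) ht.1)
  simp only [Nat.cast_zero, zero_add] at hadj
  rw [← hadj]
  refine Finset.sum_congr rfl fun m _ ↦ ?_
  rw [Nat.cast_succ, integral_of_le (by simp), integral_of_le (by simp),
    integral_Ioc_eq_integral_Ioo, integral_Ioc_eq_integral_Ioo]
  refine setIntegral_congr_fun measurableSet_Ioo fun t ht ↦ ?_
  have h1 : t ∈ Ioi (1 : ℝ) := lt_of_le_of_lt (by simp) ht.1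
  have h2 : Int.fract t = t - (m + 1) := by
    rw [Int.fract_eq_iff]
    exact ⟨by linarith [ht.1], by linarith [ht.2], m + 1, by push_cast; ring⟩
  simp only [hF, bernoulliFourKernel, indicator_of_mem h1, h2, smul_eq_mul]
  congr 2
  ring

lemma hasDerivAt_ofReal_cpow_of_eq {t : ℝ} (ht : t ≠ 0) {r q : ℂ} (hr : r ≠ 0) (hq : q = r - 1) :
    HasDerivAt (fun y : ℝ ↦ (y : ℂ) ^ r) (r * (t : ℂ) ^ q) t :=
  hq ▸ hasDerivAt_ofReal_cpow_const ht hr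

/-- The boundary term of the Euler–Maclaurin formula for `∑ n ^ (-s)`. -/
noncomputable def eulerMaclaurinBoundary (s u : ℂ) : ℂ :=
  s * (s + 1) * (s + 2) / 720 * u ^ (-s - 3) - s / 12 * u ^ (-s - 1) - 1 / 2 * u ^ (-s)
    + u ^ (1 - s) / (1 - s)

lemma integral_cpow_mul_bernoulliFour {s : ℂ} (hs : 1 < s.re) {c : ℝ} (hc : 0 < c) :
    s * (s + 1) * (s + 2) * (s + 3) / 24 *
      ∫ t in c..(c + 1), (t : ℂ) ^ (-s - 4) * (bernoulliFour (t - c) : ℂ) =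
    eulerMaclaurinBoundary s ((c + 1 : ℝ) : ℂ) - eulerMaclaurinBoundary s c - (c : ℂ) ^ (-s) := by
  have hne (k : ℝ) (hk : 0 ≤ k) : -s - (k : ℂ) ≠ 0 := fun h ↦ by
    have := congrArg Complex.re h
    simp at this
    linarith
  have hne0 : -s ≠ 0 := by simpa using hne 0 le_rfl
  have hne1 : -s - 1 ≠ 0 := by simpa using hne 1 zero_le_one
  have hne2 : -s - 2 ≠ 0 := by simpa using hne 2 (by norm_num)
  have hne3 : -s - 3 ≠ 0 := by simpa using hne 3 (by norm_num)
  have hneG : 1 - s ≠ 0 := fun h ↦ by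
    have := congrArg Complex.re h
    simp at this
    linarith
  have hderiv (t : ℝ) (ht : t ≠ 0) : HasDerivAt (fun t : ℝ ↦
      (((t : ℂ) - c) ^ 4 - 2 * ((t : ℂ) - c) ^ 3 + ((t : ℂ) - c) ^ 2 - 1 / 30) / 24 *
        (-(s * (s + 1) * (s + 2)) * (t : ℂ) ^ (-s - 3))
      - (((t : ℂ) - c) ^ 3 - 3 / 2 * ((t : ℂ) - c) ^ 2 + 1 / 2 * ((t : ℂ) - c)) / 6 *
        (s * (s + 1) * (t : ℂ) ^ (-s - 2))
      + (((t : ℂ) - c) ^ 2 - ((t : ℂ) - c) + 1 / 6) / 2 * (-s * (t : ℂ) ^ (-s - 1))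
      - (((t : ℂ) - c) - 1 / 2) * (t : ℂ) ^ (-s)
      + (t : ℂ) ^ (1 - s) / (1 - s))
      (s * (s + 1) * (s + 2) * (s + 3) / 24 *
        ((t : ℂ) ^ (-s - 4) * (bernoulliFour (t - c) : ℂ))) t := by
    have hu : HasDerivAt (fun t : ℝ ↦ (t : ℂ) - c) 1 t :=
      (Complex.ofRealCLM.hasDerivAt (x := t)).sub_const _
    have hG := hasDerivAt_ofReal_cpow_of_eq ht hneG (q := -s) (by ring)
    have h0 := hasDerivAt_ofReal_cpow_of_eq ht hne0 (q := -s - 1) (by ring)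
    have h1 := hasDerivAt_ofReal_cpow_of_eq ht hne1 (q := -s - 2) (by ring)
    have h2 := hasDerivAt_ofReal_cpow_of_eq ht hne2 (q := -s - 3) (by ring)
    have h3 := hasDerivAt_ofReal_cpow_of_eq ht hne3 (q := -s - 4) (by ring)
    have hB4 := ((((hu.pow 4).sub ((hu.pow 3).const_mul 2)).add (hu.pow 2)).sub_const
      (1 / 30)).div_const 24
    have hB3 := (((hu.pow 3).sub ((hu.pow 2).const_mul (3 / 2))).add
      (hu.const_mul (1 / 2))).div_const 6
    have hB2 := (((hu.pow 2).sub hu).add_const (1 / 6)).div_const 2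
    have hB1 := hu.sub_const (1 / 2)
    refine (((((hB4.mul (h3.const_mul (-(s * (s + 1) * (s + 2))))).sub
      (hB3.mul (h2.const_mul (s * (s + 1))))).add (hB2.mul (h1.const_mul (-s)))).sub
      (hB1.mul h0)).add (hG.div_const (1 - s))).congr_deriv ?_
    rw [mul_div_cancel_left₀ _ hneG]
    simp only [bernoulliFour, Pi.sub_apply, Pi.add_apply, Pi.pow_apply]
    push_cast
    ring
  rw [← intervalIntegral.integral_const_mul, integral_eq_sub_of_hasDerivAt (fun t ht ↦ hderiv t ?_)]
  · simp only [eulerMaclaurinBoundary]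
    push_cast
    ring
  · refine ContinuousOn.intervalIntegrable ?_
    refine continuousOn_const.mul (ContinuousOn.mul ?_ ?_)
    · intro t ht
      rw [uIcc_of_le (by linarith)] at ht
      exact (Complex.continuousAt_ofReal_cpow_const t _
        (Or.inr (hc.trans_le ht.1).ne')).continuousWithinAt
    · exact (Complex.continuous_ofReal.comp
        (continuous_bernoulliFour.comp (continuous_id.sub continuous_const))).continuousOn
  · rw [uIcc_of_le (by linarith)] at ht
    exact (hc.trans_le ht.1).ne'

lemma tendsto_natCast_add_one_cpow_zero {r : ℂ} (hr : r.re < 0) :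
    Tendsto (fun N : ℕ ↦ ((N + 1 : ℝ) : ℂ) ^ r) atTop (𝓝 0) := by
  rw [tendsto_zero_iff_norm_tendsto_zero]
  have h := (tendsto_rpow_neg_atTop (y := -r.re) (by linarith)).comp
    (tendsto_atTop_add_const_right atTop (1 : ℝ) (tendsto_natCast_atTop_atTop (R := ℝ)))
  refine h.congr fun N ↦ ?_
  rw [Complex.norm_cpow_eq_rpow_re_of_pos (by positivity)]
  simp

lemma tendsto_eulerMaclaurinBoundary {s : ℂ} (hs : 1 < s.re) :
    Tendsto (fun N : ℕ ↦ eulerMaclaurinBoundary s ((N + 1 : ℝ) : ℂ)) atTop (𝓝 0) := by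
  have h3 := (tendsto_natCast_add_one_cpow_zero (r := -s - 3) (by simp; linarith)).const_mul
    (s * (s + 1) * (s + 2) / 720)
  have h1 := (tendsto_natCast_add_one_cpow_zero (r := -s - 1) (by simp; linarith)).const_mul (s / 12)
  have h0 := (tendsto_natCast_add_one_cpow_zero (r := -s) (by simp; linarith)).const_mul (1 / 2)
  have hG := (tendsto_natCast_add_one_cpow_zero (r := 1 - s) (by simp; linarith)).div_const (1 - s)
  simpa [eulerMaclaurinBoundary] using ((h3.sub h1).sub h0).add hG

lemma riemannZeta_eq_eulerMaclaurin_of_one_lt_re {s : ℂ} (hs : 1 < s.re) :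
    riemannZeta s = -eulerMaclaurinBoundary s 1 -
      s * (s + 1) * (s + 2) * (s + 3) / 24 * eulerMaclaurinRemainder s := by
  have hR := (tendsto_sum_integral_bernoulliFour (s := s) (by linarith)).const_mul
    (s * (s + 1) * (s + 2) * (s + 3) / 24)
  have hsum : Summable fun n : ℕ ↦ 1 / (n + 1 : ℂ) ^ s := by
    have := (summable_nat_add_iff 1).mpr (Complex.summable_one_div_nat_cpow.mpr hs)
    simpa using this
  have hZ := hsum.hasSum.tendsto_sum_nat
  rw [← zeta_eq_tsum_one_div_nat_add_one_cpow hs] at hZ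
  have hP := ((tendsto_eulerMaclaurinBoundary hs).sub_const (eulerMaclaurinBoundary s 1)).sub hZ
  have := tendsto_nhds_unique (hR.congr fun N ↦ ?_) hP
  · rw [this]
    ring
  · rw [Finset.mul_sum]
    induction N with
    | zero => simp
    | succ N ih =>
      rw [Finset.sum_range_succ, Finset.sum_range_succ, ih,
        integral_cpow_mul_bernoulliFour hs (by positivity), Complex.cpow_neg]
      push_cast
      ring

lemma riemannZeta₀_eq_eulerMaclaurin {s : ℂ} (hs : -3 < s.re) :
    riemannZeta₀ s = 1 / 2 + s / 12 - s * (s + 1) * (s + 2) / 720 -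
      s * (s + 1) * (s + 2) * (s + 3) / 24 * eulerMaclaurinRemainder s := by
  have hopen : IsOpen {s : ℂ | -3 < s.re} := isOpen_lt continuous_const Complex.continuous_re
  refine AnalyticOnNhd.eqOn_of_preconnected_of_eventuallyEq (𝕜 := ℂ) (f := riemannZeta₀)
    (g := fun s ↦ 1 / 2 + s / 12 - s * (s + 1) * (s + 2) / 720 -
      s * (s + 1) * (s + 2) * (s + 3) / 24 * eulerMaclaurinRemainder s)
    (U := {s : ℂ | -3 < s.re}) (z₀ := 2) ?_ ?_ ?_ (by norm_num) ?_ hs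
  · exact differentiable_riemannZeta₀.differentiableOn.analyticOnNhd hopen
  · refine DifferentiableOn.analyticOnNhd (fun s hs ↦ ?_) hopen
    have := differentiableAt_eulerMaclaurinRemainder hs
    exact DifferentiableAt.differentiableWithinAt (by fun_prop)
  · exact (convex_halfSpace_re_gt (-3)).isPreconnected
  · filter_upwards [(isOpen_lt continuous_const Complex.continuous_re).mem_nhds
      (show (1 : ℝ) < (2 : ℂ).re by norm_num)] with s hs
    have hs1 : s ≠ 1 := by
      rintro rfl
      simp at hs
    have h := riemannZeta_eq_eulerMaclaurin_of_one_lt_re hs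
    rw [riemannZeta_eq_inv_sub_add hs1] at h
    rw [← add_right_inj (s - 1)⁻¹, h, eulerMaclaurinBoundary]
    have h1 : (1 - s)⁻¹ = -(s - 1)⁻¹ := by rw [← inv_neg, neg_sub]
    simp only [Complex.one_cpow, one_div, h1]
    ring

lemma hasDerivAt_riemannZeta₀_neg_one :
    HasDerivAt riemannZeta₀ (1 / 12 + 1 / 720 + eulerMaclaurinRemainder (-1) / 12) (-1) := by
  have hs : -3 < (-1 : ℂ).re := by norm_num
  have hev : riemannZeta₀ =ᶠ[𝓝 (-1)] fun s ↦ 1 / 2 + s / 12 - s * (s + 1) * (s + 2) / 720 -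
      s * (s + 1) * (s + 2) * (s + 3) / 24 * eulerMaclaurinRemainder s := by
    filter_upwards [(isOpen_lt continuous_const Complex.continuous_re).mem_nhds hs] with s hs
      using riemannZeta₀_eq_eulerMaclaurin hs
  have hM := (differentiableAt_eulerMaclaurinRemainder hs).hasDerivAt
  have hi := hasDerivAt_id (-1 : ℂ)
  have hp := (hi.mul (hi.add_const 1)).mul (hi.add_const 2)
  refine HasDerivAt.congr_of_eventuallyEq ?_ hev
  refine ((((hi.div_const 12).const_add (1 / 2)).sub (hp.div_const 720)).sub
    (((hp.mul (hi.add_const 3)).div_const 24).mul hM)).congr_deriv ?_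
  simp
  ring

lemma hasDerivAt_riemannZeta₀_neg_two :
    HasDerivAt riemannZeta₀ (1 / 12 - 1 / 360 - eulerMaclaurinRemainder (-2) / 12) (-2) := by
  have hs : -3 < (-2 : ℂ).re := by norm_num
  have hev : riemannZeta₀ =ᶠ[𝓝 (-2)] fun s ↦ 1 / 2 + s / 12 - s * (s + 1) * (s + 2) / 720 -
      s * (s + 1) * (s + 2) * (s + 3) / 24 * eulerMaclaurinRemainder s := by
    filter_upwards [(isOpen_lt continuous_const Complex.continuous_re).mem_nhds hs] with s hs
      using riemannZeta₀_eq_eulerMaclaurin hs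
  have hM := (differentiableAt_eulerMaclaurinRemainder hs).hasDerivAt
  have hi := hasDerivAt_id (-2 : ℂ)
  have hp := (hi.mul (hi.add_const 1)).mul (hi.add_const 2)
  refine HasDerivAt.congr_of_eventuallyEq ?_ hev
  refine ((((hi.div_const 12).const_add (1 / 2)).sub (hp.div_const 720)).sub
    (((hp.mul (hi.add_const 3)).div_const 24).mul hM)).congr_deriv ?_
  simp
  ring

lemma deriv_riemannZeta_neg_one :
    deriv riemannZeta (-1) = -1 / 6 + 1 / 720 + eulerMaclaurinRemainder (-1) / 12 := by
  rw [deriv_riemannZeta_eq_neg_inv_sub_sq_add (by norm_num), hasDerivAt_riemannZeta₀_neg_one.deriv]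
  ring

lemma deriv_riemannZeta_neg_two :
    deriv riemannZeta (-2) = -1 / 36 - 1 / 360 - eulerMaclaurinRemainder (-2) / 12 := by
  rw [deriv_riemannZeta_eq_neg_inv_sub_sq_add (by norm_num), hasDerivAt_riemannZeta₀_neg_two.deriv]
  ring

lemma deriv_riemannZeta_neg_two_eq :
    deriv riemannZeta (-2) = -riemannZeta 3 / (4 * (Real.pi : ℂ) ^ 2) := by
  have hpi : (Real.pi : ℂ) ≠ 0 := Complex.ofReal_ne_zero.mpr Real.pi_ne_zero
  have hL : HasDerivAt (fun s : ℂ ↦ riemannZeta (1 - s)) (-deriv riemannZeta (-2)) 3 := by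
    have h : HasDerivAt riemannZeta (deriv riemannZeta (-2)) (1 - 3) := by
      rw [show (1 - 3 : ℂ) = -2 by norm_num]
      exact (differentiableAt_riemannZeta (by norm_num)).hasDerivAt
    exact h.comp_const_sub 1 3
  have hev : (fun s : ℂ ↦ riemannZeta (1 - s)) =ᶠ[𝓝 3] fun s ↦
      (2 * (2 * (Real.pi : ℂ)) ^ (-s) * Complex.Gamma s * riemannZeta s) *
        Complex.cos (Real.pi * s / 2) := by
    filter_upwards [(isOpen_lt continuous_const Complex.continuous_re).mem_nhds
      (show (1 : ℝ) < (3 : ℂ).re by norm_num)] with s hs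
    rw [riemannZeta_one_sub]
    · ring
    · rintro n rfl
      simp at hs
      linarith [(Nat.cast_nonneg n : (0 : ℝ) ≤ n)]
    · rintro rfl
      simp at hs
  have hcos0 : Complex.cos (Real.pi * 3 / 2) = 0 := by
    rw [show (Real.pi * 3 / 2 : ℂ) = Real.pi / 2 + Real.pi by ring, Complex.cos_add_pi,
      Complex.cos_pi_div_two, neg_zero]
  have hsin : Complex.sin (Real.pi * 3 / 2) = -1 := by
    rw [show (Real.pi * 3 / 2 : ℂ) = Real.pi / 2 + Real.pi by ring, Complex.sin_add_pi,
      Complex.sin_pi_div_two]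
  have hG : DifferentiableAt ℂ (fun s : ℂ ↦
      2 * (2 * (Real.pi : ℂ)) ^ (-s) * Complex.Gamma s * riemannZeta s) 3 := by
    refine ((DifferentiableAt.const_mul ?_ _).mul ?_).mul (differentiableAt_riemannZeta (by norm_num))
    · exact DifferentiableAt.const_cpow (by fun_prop) (Or.inl (by simp))
    · refine Complex.differentiableAt_Gamma _ fun m h ↦ ?_
      have := congrArg Complex.re h
      simp at this
      linarith [(Nat.cast_nonneg m : (0 : ℝ) ≤ m)]
  have hC : HasDerivAt (fun s : ℂ ↦ Complex.cos (Real.pi * s / 2)) (Real.pi / 2) 3 := by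
    have h := (((hasDerivAt_id (3 : ℂ)).const_mul (Real.pi : ℂ)).div_const 2).ccos
    refine h.congr_deriv ?_
    simp [hsin]
  have hR := (hG.hasDerivAt.mul hC).congr_of_eventuallyEq hev
  have hGamma : Complex.Gamma 3 = 2 := by
    rw [show (3 : ℂ) = (2 : ℕ) + 1 by norm_num, Complex.Gamma_nat_eq_factorial]
    norm_num
  have h := hL.unique hR
  rw [hcos0, mul_zero, zero_add, hGamma, Complex.cpow_neg,
    show (3 : ℂ) = (3 : ℕ) by norm_num, Complex.cpow_natCast] at h
  rw [eq_comm, ← neg_inj, h]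
  norm_num
  field_simp
  ring

lemma intervalIntegrable_bernoulliFour_div_pow {c : ℝ} (hc : 0 < c) (k : ℕ) :
    IntervalIntegrable (fun t ↦ bernoulliFour (t - c) / t ^ k) volume c (c + 1) := by
  refine ContinuousOn.intervalIntegrable fun t ht ↦ ContinuousAt.continuousWithinAt ?_
  rw [uIcc_of_le (by linarith)] at ht
  exact (continuous_bernoulliFour.comp (continuous_id.sub continuous_const)).continuousAt.div
    (by fun_prop) (pow_ne_zero _ (hc.trans_le ht.1).ne')

lemma intervalIntegrable_mul_log_add {p : ℝ → ℝ} (hp : Continuous p) (c a b : ℝ) :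
    IntervalIntegrable (fun x ↦ p x * Real.log (x + c)) volume a b := by
  have h := (intervalIntegrable_log' (a := a + c) (b := b + c)).comp_add_right c
  simp only [add_sub_cancel_right] at h
  exact h.continuousOn_mul hp.continuousOn

lemma integral_bernoulliTwo_mul_log {c : ℝ} (hc : 0 < c) :
    ∫ x in (0 : ℝ)..1, (x ^ 2 - x + 1 / 6) * Real.log (x + c) =
      1 / 360 * ((c + 1)⁻¹ - c⁻¹) - 1 / 12 * ∫ t in c..(c + 1), bernoulliFour (t - c) / t ^ 2 := by
  have hshift : ∫ x in (0 : ℝ)..1, (x ^ 2 - x + 1 / 6) * Real.log (x + c) =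
      ∫ t in c..(c + 1), ((t - c) ^ 2 - (t - c) + 1 / 6) * Real.log t := by
    have := integral_comp_add_right (a := 0) (b := 1)
      (fun t ↦ ((t - c) ^ 2 - (t - c) + 1 / 6) * Real.log t) c
    simpa [add_comm] using this
  have hderiv (t : ℝ) (ht : 0 < t) : HasDerivAt (fun t : ℝ ↦
      ((t - c) ^ 3 - 3 / 2 * (t - c) ^ 2 + 1 / 2 * (t - c)) / 3 * Real.log t
      - ((t - c) ^ 4 - 2 * (t - c) ^ 3 + (t - c) ^ 2 - 1 / 30) / 12 * t⁻¹)
      (((t - c) ^ 2 - (t - c) + 1 / 6) * Real.log t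
        + 1 / 12 * (bernoulliFour (t - c) / t ^ 2)) t := by
    have hu : HasDerivAt (fun t : ℝ ↦ t - c) 1 t := (hasDerivAt_id t).sub_const _
    have hB4 := ((((hu.pow 4).sub ((hu.pow 3).const_mul 2)).add (hu.pow 2)).sub_const
      (1 / 30)).div_const 12
    have hB3 := (((hu.pow 3).sub ((hu.pow 2).const_mul (3 / 2))).add
      (hu.const_mul (1 / 2))).div_const 3
    refine ((hB3.mul (Real.hasDerivAt_log ht.ne')).sub
      (hB4.mul (hasDerivAt_inv ht.ne'))).congr_deriv ?_
    simp only [bernoulliFour, Pi.sub_apply, Pi.add_apply, Pi.pow_apply]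
    field_simp
    ring
  have hint : IntervalIntegrable (fun t ↦ ((t - c) ^ 2 - (t - c) + 1 / 6) * Real.log t)
      volume c (c + 1) :=
    intervalIntegrable_log'.continuousOn_mul (by fun_prop)
  have hB := (intervalIntegrable_bernoulliFour_div_pow hc 2).const_mul (1 / 12)
  have hFTC := integral_eq_sub_of_hasDerivAt (fun t ht ↦ hderiv t ?_) (hint.add hB)
  · rw [integral_add hint hB, intervalIntegral.integral_const_mul] at hFTC
    rw [hshift, eq_sub_iff_add_eq, hFTC]
    norm_num
    ring
  · rw [uIcc_of_le (by linarith)] at ht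
    exact hc.trans_le ht.1

lemma integral_bernoulliOne_mul_log {c : ℝ} (hc : 0 < c) :
    ∫ x in (0 : ℝ)..1, (x - 1 / 2) * Real.log (x + c) =
      1 / 12 * (Real.log (c + 1) - Real.log c) + 1 / 720 * (((c + 1) ^ 2)⁻¹ - (c ^ 2)⁻¹)
        - 1 / 12 * ∫ t in c..(c + 1), bernoulliFour (t - c) / t ^ 3 := by
  have hshift : ∫ x in (0 : ℝ)..1, (x - 1 / 2) * Real.log (x + c) =
      ∫ t in c..(c + 1), (t - c - 1 / 2) * Real.log t := by
    have := integral_comp_add_right (a := 0) (b := 1)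
      (fun t ↦ (t - c - 1 / 2) * Real.log t) c
    simpa [add_comm] using this
  have hderiv (t : ℝ) (ht : 0 < t) : HasDerivAt (fun t : ℝ ↦
      ((t - c) ^ 2 - (t - c) + 1 / 6) / 2 * Real.log t
      - ((t - c) ^ 3 - 3 / 2 * (t - c) ^ 2 + 1 / 2 * (t - c)) / 6 * t⁻¹
      - ((t - c) ^ 4 - 2 * (t - c) ^ 3 + (t - c) ^ 2 - 1 / 30) / 24 * (t ^ 2)⁻¹)
      ((t - c - 1 / 2) * Real.log t + 1 / 12 * (bernoulliFour (t - c) / t ^ 3)) t := by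
    have hu : HasDerivAt (fun t : ℝ ↦ t - c) 1 t := (hasDerivAt_id t).sub_const _
    have hB4 := ((((hu.pow 4).sub ((hu.pow 3).const_mul 2)).add (hu.pow 2)).sub_const
      (1 / 30)).div_const 24
    have hB3 := (((hu.pow 3).sub ((hu.pow 2).const_mul (3 / 2))).add
      (hu.const_mul (1 / 2))).div_const 6
    have hB2 := (((hu.pow 2).sub hu).add_const (1 / 6)).div_const 2
    refine (((hB2.mul (Real.hasDerivAt_log ht.ne')).sub
      (hB3.mul (hasDerivAt_inv ht.ne'))).sub
      (hB4.mul ((hasDerivAt_pow 2 t).inv (pow_ne_zero 2 ht.ne')))).congr_deriv ?_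
    simp only [bernoulliFour, Pi.sub_apply, Pi.add_apply, Pi.pow_apply, Pi.inv_apply]
    field_simp
    ring
  have hint : IntervalIntegrable (fun t ↦ (t - c - 1 / 2) * Real.log t) volume c (c + 1) :=
    intervalIntegrable_log'.continuousOn_mul (by fun_prop)
  have hB := (intervalIntegrable_bernoulliFour_div_pow hc 3).const_mul (1 / 12)
  have hFTC := integral_eq_sub_of_hasDerivAt (fun t ht ↦ hderiv t ?_) (hint.add hB)
  · rw [integral_add hint hB, intervalIntegral.integral_const_mul] at hFTC
    rw [hshift, eq_sub_iff_add_eq, hFTC]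
    norm_num
    ring
  · rw [uIcc_of_le (by linarith)] at ht
    exact hc.trans_le ht.1

lemma tendsto_sum_integral_bernoulliFour_div_pow {k : ℕ} (hk : 1 < k) :
    Tendsto (fun N : ℕ ↦ ∑ m ∈ Finset.range N, ∫ t in (m + 1 : ℝ)..(m + 1 + 1),
      bernoulliFour (t - (m + 1)) / t ^ k) atTop
      (𝓝 (eulerMaclaurinRemainder (k - 4)).re) := by
  have hk' : (1 : ℝ) < k := by exact_mod_cast hk
  have h := tendsto_sum_integral_bernoulliFour (s := k - 4) (by simp; linarith)
  refine ((Complex.continuous_re.tendsto _).comp h).congr fun N ↦ ?_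
  rw [Function.comp_apply, Complex.re_sum]
  refine Finset.sum_congr rfl fun m _ ↦ ?_
  rw [← Complex.ofReal_re (∫ t in (m + 1 : ℝ)..(m + 1 + 1), _), ← intervalIntegral.integral_ofReal]
  congr 2
  ext t
  rw [show (-(k - 4 : ℂ) - 4) = -(k : ℂ) by ring, Complex.cpow_neg, Complex.cpow_natCast]
  push_cast
  ring

lemma intervalIntegrable_log_Gamma :
    IntervalIntegrable (fun x ↦ Real.log (Real.Gamma x)) volume 0 1 := by
  have h : IntervalIntegrable (fun x ↦ Real.log (Real.Gamma (x + 1)) - Real.log x) volume 0 1 := by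
    refine IntervalIntegrable.sub (ContinuousOn.intervalIntegrable fun x hx ↦ ?_)
      intervalIntegrable_log'
    rw [uIcc_of_le zero_le_one] at hx
    have hx1 : 0 < x + 1 := by linarith [hx.1]
    have hG : ContinuousAt Real.Gamma (x + 1) := (Real.differentiableAt_Gamma fun m h ↦ by
      linarith [(Nat.cast_nonneg m : (0 : ℝ) ≤ m)]).continuousAt
    exact ((hG.comp (f := fun x : ℝ ↦ x + 1) (by fun_prop)).log
      (Real.Gamma_pos_of_pos hx1).ne').continuousWithinAt
  refine h.congr fun x hx ↦ ?_
  rw [uIoc_of_le zero_le_one] at hx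
  simp only [Real.Gamma_add_one hx.1.ne', Real.log_mul hx.1.ne' (Real.Gamma_pos_of_pos hx.1).ne']
  ring

lemma integral_log_Gamma :
    ∫ x in (0 : ℝ)..1, Real.log (Real.Gamma x) = 1 / 2 * Real.log (2 * Real.pi) := by
  have hrefl : ∫ x in (0 : ℝ)..1, Real.log (Real.Gamma (1 - x)) =
      ∫ x in (0 : ℝ)..1, Real.log (Real.Gamma x) := by
    simpa using integral_comp_sub_left (a := 0) (b := 1) (fun x ↦ Real.log (Real.Gamma x)) 1
  have hint' : IntervalIntegrable (fun x ↦ Real.log (Real.Gamma (1 - x))) volume 0 1 := by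
    simpa using (intervalIntegrable_log_Gamma.comp_sub_left 1).symm
  have hsin : ∫ x in (0 : ℝ)..1, Real.log (Real.sin (Real.pi * x)) = -Real.log 2 := by
    rw [integral_comp_mul_left (fun x ↦ Real.log (Real.sin x)) Real.pi_ne_zero, mul_zero, mul_one,
      integral_log_sin_zero_pi, smul_eq_mul]
    field_simp
  have hsinint : IntervalIntegrable (fun x ↦ Real.log (Real.sin (Real.pi * x))) volume 0 1 := by
    simpa [Real.pi_ne_zero] using
      (intervalIntegrable_log_sin (a := 0) (b := Real.pi)).comp_mul_left (c := Real.pi)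
  have hsum : (∫ x in (0 : ℝ)..1, Real.log (Real.Gamma x)) +
      ∫ x in (0 : ℝ)..1, Real.log (Real.Gamma (1 - x)) =
      ∫ x in (0 : ℝ)..1, (Real.log Real.pi - Real.log (Real.sin (Real.pi * x))) := by
    rw [← integral_add intervalIntegrable_log_Gamma hint']
    rw [integral_of_le zero_le_one, integral_of_le zero_le_one,
      integral_Ioc_eq_integral_Ioo, integral_Ioc_eq_integral_Ioo]
    refine setIntegral_congr_fun measurableSet_Ioo fun x hx ↦ ?_
    have h1 : 0 < 1 - x := by linarith [hx.2]
    have hs : 0 < Real.sin (Real.pi * x) := Real.sin_pos_of_pos_of_lt_pi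
      (mul_pos Real.pi_pos hx.1) (by nlinarith [Real.pi_pos, hx.2])
    rw [← Real.log_mul (Real.Gamma_pos_of_pos hx.1).ne' (Real.Gamma_pos_of_pos h1).ne',
      Real.Gamma_mul_Gamma_one_sub, Real.log_div Real.pi_ne_zero hs.ne']
  rw [hrefl, intervalIntegral.integral_sub (by simp) hsinint, hsin] at hsum
  simp only [intervalIntegral.integral_const, sub_zero, one_smul] at hsum
  rw [Real.log_mul two_ne_zero Real.pi_ne_zero]
  linarith

lemma integral_mul_logGammaSeq {p : ℝ → ℝ} (hp : Continuous p) (N : ℕ) :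
    ∫ x in (0 : ℝ)..1, p x * Real.BohrMollerup.logGammaSeq x N =
      (∫ x in (0 : ℝ)..1, p x * x) * Real.log N + (∫ x in (0 : ℝ)..1, p x) * Real.log N.factorial
        - (∫ x in (0 : ℝ)..1, p x * Real.log x)
        - ∑ m ∈ Finset.range N, ∫ x in (0 : ℝ)..1, p x * Real.log (x + (m + 1)) := by
  have hi1 : IntervalIntegrable (fun x ↦ p x * x * Real.log N) volume 0 1 :=
    Continuous.intervalIntegrable (by fun_prop) _ _
  have hi2 : IntervalIntegrable (fun x ↦ p x * Real.log N.factorial) volume 0 1 :=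
    Continuous.intervalIntegrable (by fun_prop) _ _
  have hi3 : IntervalIntegrable (fun x ↦ p x * Real.log x) volume 0 1 := by
    simpa using intervalIntegrable_mul_log_add hp 0 0 1
  have hi4 (m : ℕ) : IntervalIntegrable (fun x ↦ p x * Real.log (x + (m + 1))) volume 0 1 :=
    intervalIntegrable_mul_log_add hp (m + 1) 0 1
  have hi5 : IntervalIntegrable
      (fun x ↦ ∑ m ∈ Finset.range N, p x * Real.log (x + (m + 1))) volume 0 1 := by
    simpa only [Finset.sum_fn] using IntervalIntegrable.sum (Finset.range N) fun m _ ↦ hi4 m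
  rw [← integral_finsetSum fun m _ ↦ hi4 m, ← intervalIntegral.integral_mul_const,
    ← intervalIntegral.integral_mul_const, ← integral_add hi1 hi2,
    ← integral_sub (hi1.add hi2) hi3, ← integral_sub ((hi1.add hi2).sub hi3) hi5]
  congr 1
  ext x
  rw [Real.BohrMollerup.logGammaSeq, Finset.sum_range_succ', ← Finset.mul_sum]
  push_cast
  rw [add_zero]
  ring

lemma tendsto_integral_mul_logGammaSeq {p : ℝ → ℝ} (hp : Continuous p) :
    Tendsto (fun N : ℕ ↦ ∫ x in (0 : ℝ)..1, p x * Real.BohrMollerup.logGammaSeq x N) atTop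
      (𝓝 (∫ x in (0 : ℝ)..1, p x * Real.log (Real.Gamma x))) := by
  refine tendsto_integral_filter_of_dominated_convergence
    (fun x ↦ ‖p x‖ * (‖Real.log (Real.Gamma x)‖ + Real.log 2)) ?_ ?_ ?_ ?_
  · refine Eventually.of_forall fun N ↦ ?_
    have : Measurable fun x ↦ Real.BohrMollerup.logGammaSeq x N := by
      unfold Real.BohrMollerup.logGammaSeq
      fun_prop
    exact (hp.measurable.mul this).aestronglyMeasurable
  · filter_upwards [eventually_ne_atTop 0] with N hN
    filter_upwards with x hx
    rw [uIoc_of_le zero_le_one] at hx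
    have hfeq {y : ℝ} (hy : 0 < y) :
        (Real.log ∘ Real.Gamma) (y + 1) = (Real.log ∘ Real.Gamma) y + Real.log y := by
      simp only [Function.comp_apply, Real.Gamma_add_one hy.ne',
        Real.log_mul hy.ne' (Real.Gamma_pos_of_pos hy).ne']
      ring
    have hle := Real.BohrMollerup.le_logGammaSeq Real.convexOn_log_Gamma hfeq hx.1 hx.2 N
    have hge := Real.BohrMollerup.ge_logGammaSeq Real.convexOn_log_Gamma hfeq hx.1 hN
    simp only [Function.comp_apply, Real.Gamma_one, Real.log_one, zero_add] at hle hge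
    have hN0 : (1 : ℝ) ≤ N := by exact_mod_cast Nat.one_le_iff_ne_zero.mpr hN
    have hlog : Real.log (N + 1) - Real.log N ≤ Real.log 2 := by
      rw [← Real.log_div (by positivity) (by positivity)]
      refine Real.log_le_log (by positivity) ?_
      rw [div_le_iff₀ (by positivity)]
      linarith
    have hlog0 : 0 ≤ Real.log (N + 1) - Real.log N :=
      sub_nonneg.mpr (Real.log_le_log (by positivity) (by linarith))
    have hx1 : x * (Real.log (N + 1) - Real.log N) ≤ Real.log 2 :=
      (mul_le_of_le_one_left hlog0 hx.2).trans hlog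
    rw [norm_mul]
    refine mul_le_mul_of_nonneg_left ?_ (norm_nonneg _)
    rw [Real.norm_eq_abs, Real.norm_eq_abs]
    have h2 : 0 ≤ Real.log 2 := Real.log_nonneg one_le_two
    rw [abs_le]
    constructor
    · linarith [neg_abs_le (Real.log (Real.Gamma x))]
    · linarith [le_abs_self (Real.log (Real.Gamma x))]
  · exact (intervalIntegrable_log_Gamma.norm.add (by simp)).continuousOn_mul
      hp.norm.continuousOn
  · filter_upwards with x hx
    rw [uIoc_of_le zero_le_one] at hx
    exact (Real.BohrMollerup.tendsto_log_gamma hx.1).const_mul (p x)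

lemma tendsto_natCast_add_one_inv : Tendsto (fun N : ℕ ↦ ((N : ℝ) + 1)⁻¹) atTop (𝓝 0) := by
  simpa using tendsto_one_div_add_atTop_nhds_zero_nat (𝕜 := ℝ)

lemma integral_bernoulliTwo_mul_log_Gamma :
    ∫ x in (0 : ℝ)..1, (x ^ 2 - x + 1 / 6) * Real.log (Real.Gamma x) =
      1 / 36 + 1 / 360 + 1 / 12 * (eulerMaclaurinRemainder (-2)).re := by
  have hp : Continuous fun x : ℝ ↦ x ^ 2 - x + 1 / 6 := by fun_prop
  have hR := tendsto_sum_integral_bernoulliFour_div_pow (k := 2) one_lt_two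
  rw [show ((2 : ℕ) - 4 : ℂ) = -2 by norm_num] at hR
  refine tendsto_nhds_unique (tendsto_integral_mul_logGammaSeq hp) ?_
  have h0 : ∫ x in (0 : ℝ)..1, (x ^ 2 - x + 1 / 6) = 0 := by
    rw [integral_eq_sub_of_hasDerivAt (f := fun x ↦ x ^ 3 / 3 - x ^ 2 / 2 + x / 6)
      (fun x _ ↦ ?_) (hp.intervalIntegrable _ _)]
    · norm_num
    · refine ((((hasDerivAt_pow 3 x).div_const 3).sub ((hasDerivAt_pow 2 x).div_const 2)).add
        ((hasDerivAt_id x).div_const 6)).congr_deriv ?_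
      norm_num
  have h1 : ∫ x in (0 : ℝ)..1, (x ^ 2 - x + 1 / 6) * x = 0 := by
    rw [integral_eq_sub_of_hasDerivAt (f := fun x ↦ x ^ 4 / 4 - x ^ 3 / 3 + x ^ 2 / 12)
      (fun x _ ↦ ?_) (Continuous.intervalIntegrable (by fun_prop) _ _)]
    · norm_num
    · refine ((((hasDerivAt_pow 4 x).div_const 4).sub ((hasDerivAt_pow 3 x).div_const 3)).add
        ((hasDerivAt_pow 2 x).div_const 12)).congr_deriv ?_
      norm_num
      ring
  have hlog : ∫ x in (0 : ℝ)..1, (x ^ 2 - x + 1 / 6) * Real.log x = -1 / 36 := by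
    rw [integral_eq_sub_of_hasDerivAt_of_le (f := fun x ↦
      (x ^ 2 / 3 - x / 2 + 1 / 6) * (x * Real.log x) - x ^ 3 / 9 + x ^ 2 / 4 - x / 6)
      zero_le_one (by have := Real.continuous_mul_log; fun_prop) (fun x hx ↦ ?_)
      (intervalIntegrable_log'.continuousOn_mul hp.continuousOn)]
    · norm_num
    · have hq := (((hasDerivAt_pow 2 x).div_const 3).sub ((hasDerivAt_id x).div_const 2)).add_const
        (1 / 6)
      refine ((((hq.mul (Real.hasDerivAt_mul_log hx.1.ne')).sub
        ((hasDerivAt_pow 3 x).div_const 9)).add ((hasDerivAt_pow 2 x).div_const 4)).sub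
        ((hasDerivAt_id x).div_const 6)).congr_deriv ?_
      norm_num
      ring
  have hlim := ((tendsto_natCast_add_one_inv.sub_const 1).const_mul (1 / 360)).sub
    (hR.const_mul (1 / 12))
  refine ((hlim.const_sub (1 / 36)).congr fun N ↦ ?_).trans_eq ?_
  · rw [integral_mul_logGammaSeq hp, h0, h1, hlog]
    suffices ∑ m ∈ Finset.range N,
        ∫ x in (0 : ℝ)..1, (x ^ 2 - x + 1 / 6) * Real.log (x + (m + 1)) =
        1 / 360 * (((N : ℝ) + 1)⁻¹ - 1) - 1 / 12 * ∑ m ∈ Finset.range N,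
          ∫ t in (m + 1 : ℝ)..(m + 1 + 1), bernoulliFour (t - (m + 1)) / t ^ 2 by
      rw [this]
      ring
    induction N with
    | zero => simp
    | succ N ih =>
      rw [Finset.sum_range_succ, Finset.sum_range_succ, ih,
        integral_bernoulliTwo_mul_log (by positivity)]
      push_cast
      ring
  · congr 1
    ring

lemma integral_bernoulliOne_mul_log_Gamma :
    ∫ x in (0 : ℝ)..1, (x - 1 / 2) * Real.log (Real.Gamma x) =
      -1 / 4 + 1 / 720 + 1 / 12 * (eulerMaclaurinRemainder (-1)).re := by
  have hp : Continuous fun x : ℝ ↦ x - 1 / 2 := by fun_prop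
  have hR := tendsto_sum_integral_bernoulliFour_div_pow (k := 3) (by norm_num)
  rw [show ((3 : ℕ) - 4 : ℂ) = -1 by norm_num] at hR
  refine tendsto_nhds_unique (tendsto_integral_mul_logGammaSeq hp) ?_
  have h0 : ∫ x in (0 : ℝ)..1, (x - 1 / 2) = 0 := by
    rw [integral_eq_sub_of_hasDerivAt (f := fun x ↦ x ^ 2 / 2 - x / 2)
      (fun x _ ↦ ?_) (hp.intervalIntegrable _ _)]
    · norm_num
    · refine (((hasDerivAt_pow 2 x).div_const 2).sub
        ((hasDerivAt_id x).div_const 2)).congr_deriv ?_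
      norm_num
  have h1 : ∫ x in (0 : ℝ)..1, (x - 1 / 2) * x = 1 / 12 := by
    rw [integral_eq_sub_of_hasDerivAt (f := fun x ↦ x ^ 3 / 3 - x ^ 2 / 4)
      (fun x _ ↦ ?_) (Continuous.intervalIntegrable (by fun_prop) _ _)]
    · norm_num
    · refine (((hasDerivAt_pow 3 x).div_const 3).sub
        ((hasDerivAt_pow 2 x).div_const 4)).congr_deriv ?_
      norm_num
      ring
  have hlog : ∫ x in (0 : ℝ)..1, (x - 1 / 2) * Real.log x = 1 / 4 := by
    rw [integral_eq_sub_of_hasDerivAt_of_le (f := fun x ↦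
      (x / 2 - 1 / 2) * (x * Real.log x) - x ^ 2 / 4 + x / 2)
      zero_le_one (by have := Real.continuous_mul_log; fun_prop) (fun x hx ↦ ?_)
      (intervalIntegrable_log'.continuousOn_mul hp.continuousOn)]
    · norm_num
    · have hq := ((hasDerivAt_id x).div_const 2).sub_const (1 / 2)
      refine (((hq.mul (Real.hasDerivAt_mul_log hx.1.ne')).sub
        ((hasDerivAt_pow 2 x).div_const 4)).add ((hasDerivAt_id x).div_const 2)).congr_deriv ?_
      norm_num
      ring
  have hlim := ((Real.tendsto_log_nat_add_one_sub_log.const_mul (1 / 12)).add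
    (((tendsto_natCast_add_one_inv.pow 2).sub_const 1).const_mul (1 / 720))).sub
    (hR.const_mul (1 / 12))
  refine ((hlim.const_sub (-1 / 4)).congr fun N ↦ ?_).trans_eq ?_
  · rw [integral_mul_logGammaSeq hp, h0, h1, hlog]
    suffices ∑ m ∈ Finset.range N,
        ∫ x in (0 : ℝ)..1, (x - 1 / 2) * Real.log (x + (m + 1)) =
        1 / 12 * Real.log (N + 1) + 1 / 720 * (((N : ℝ) + 1)⁻¹ ^ 2 - 1) -
          1 / 12 * ∑ m ∈ Finset.range N,
          ∫ t in (m + 1 : ℝ)..(m + 1 + 1), bernoulliFour (t - (m + 1)) / t ^ 3 by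
      rw [this]
      ring
    induction N with
    | zero => simp
    | succ N ih =>
      rw [Finset.sum_range_succ, Finset.sum_range_succ, ih,
        integral_bernoulliOne_mul_log (by positivity)]
      simp only [inv_pow]
      push_cast
      ring
  · congr 1
    ring

theorem stmt_17 :
    ∫ x in (0:ℝ)..1, x ^ 2 * Real.log (Real.Gamma x) =
      (riemannZeta 3).re / (4 * Real.pi ^ 2) + (1/6) * Real.log (2 * Real.pi) - logA := by
  have hint {p : ℝ → ℝ} (hp : Continuous p) :
      IntervalIntegrable (fun x ↦ p x * Real.log (Real.Gamma x)) volume 0 1 :=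
    intervalIntegrable_log_Gamma.continuousOn_mul hp.continuousOn
  have hsplit : ∫ x in (0:ℝ)..1, x ^ 2 * Real.log (Real.Gamma x) =
      (∫ x in (0 : ℝ)..1, (x ^ 2 - x + 1 / 6) * Real.log (Real.Gamma x)) +
      (∫ x in (0 : ℝ)..1, (x - 1 / 2) * Real.log (Real.Gamma x)) +
      1 / 3 * ∫ x in (0 : ℝ)..1, Real.log (Real.Gamma x) := by
    rw [← intervalIntegral.integral_const_mul, ← integral_add (hint (by fun_prop))
      (hint (by fun_prop)), ← integral_add ((hint (by fun_prop)).add (hint (by fun_prop)))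
      (intervalIntegrable_log_Gamma.const_mul _)]
    congr 1
    ext x
    ring
  have h3 : (eulerMaclaurinRemainder (-2)).re / 12 =
      -1 / 36 - 1 / 360 + (riemannZeta 3).re / (4 * Real.pi ^ 2) := by
    have h := congrArg Complex.re (deriv_riemannZeta_neg_two.symm.trans deriv_riemannZeta_neg_two_eq)
    rw [show (4 * (Real.pi : ℂ) ^ 2) = ((4 * Real.pi ^ 2 : ℝ) : ℂ) by push_cast; ring,
      Complex.div_ofReal_re] at h
    simp [neg_div] at h
    linarith
  have h1 : (deriv riemannZeta (-1)).re =
      -1 / 6 + 1 / 720 + (eulerMaclaurinRemainder (-1)).re / 12 := by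
    rw [deriv_riemannZeta_neg_one]
    simp
  rw [hsplit, integral_bernoulliTwo_mul_log_Gamma, integral_bernoulliOne_mul_log_Gamma,
    integral_log_Gamma, logA, h1]
  linarith
end

section
/- ∫_0^1 (x - x^2) log Γ(x) dx = (1/12) log(2π) - ζ(3)/(4π^2). -/
theorem sin_two_pi_nat_mul_eq (n : ℕ) (x : ℝ) :
    Real.sin (2 * Real.pi * n * x) = Real.sin (Real.pi * x) *
      ∑ k ∈ Finset.range n, 2 * Real.cos ((2 * k + 1) * (Real.pi * x)) := by
  induction n with
  | zero => simp
  | succ n ih =>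
    rw [Finset.sum_range_succ, mul_add, ← ih]
    have h := Real.sin_sub_sin (2 * Real.pi * (n + 1 : ℕ) * x) (2 * Real.pi * n * x)
    have e1 : (2 * Real.pi * (n + 1 : ℕ) * x - 2 * Real.pi * n * x) / 2 = Real.pi * x := by
      push_cast; ring
    have e2 : (2 * Real.pi * (n + 1 : ℕ) * x + 2 * Real.pi * n * x) / 2 =
        (2 * n + 1) * (Real.pi * x) := by
      push_cast; ring
    rw [e1, e2] at h
    linarith

theorem integral_cos_two_pi_nat_mul (n : ℕ) :
    ∫ x in (0:ℝ)..1, Real.cos (2 * Real.pi * n * x) = if n = 0 then 1 else 0 := by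
  split_ifs with hn
  · simp [hn]
  · have hc : 2 * Real.pi * (n : ℝ) ≠ 0 := by positivity
    rw [intervalIntegral.integral_comp_mul_left (fun y => Real.cos y) hc, integral_cos]
    have : Real.sin (2 * Real.pi * n * 1) = 0 := by
      rw [← Real.sin_nat_mul_pi (2 * n)]
      congr 1
      push_cast; ring
    rw [this]
    simp

theorem integral_sum_cos_odd_mul_cos {n : ℕ} (hn : n ≠ 0) :
    ∫ x in (0:ℝ)..1, (∑ k ∈ Finset.range n, 2 * Real.cos ((2 * k + 1) * (Real.pi * x))) *
      Real.cos (Real.pi * x) = 1 := by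
  have key : ∀ x : ℝ, (∑ k ∈ Finset.range n, 2 * Real.cos ((2 * k + 1) * (Real.pi * x))) *
      Real.cos (Real.pi * x) = ∑ k ∈ Finset.range n,
        (Real.cos (2 * Real.pi * k * x) + Real.cos (2 * Real.pi * (k + 1 : ℕ) * x)) := by
    intro x
    rw [Finset.sum_mul]
    refine Finset.sum_congr rfl fun k _ => ?_
    rw [Real.two_mul_cos_mul_cos]
    congr 2 <;> push_cast <;> ring
  simp_rw [key]
  rw [intervalIntegral.integral_finsetSum
    fun k _ => (by fun_prop : Continuous _).intervalIntegrable _ _]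
  have step : ∀ k : ℕ, ∫ x in (0:ℝ)..1,
      (Real.cos (2 * Real.pi * k * x) + Real.cos (2 * Real.pi * (k + 1 : ℕ) * x)) =
        if k = 0 then 1 else 0 := by
    intro k
    rw [intervalIntegral.integral_add ((by fun_prop : Continuous _).intervalIntegrable _ _)
      ((by fun_prop : Continuous _).intervalIntegrable _ _), integral_cos_two_pi_nat_mul,
      integral_cos_two_pi_nat_mul]
    simp
  simp_rw [step]
  simp [hn]

theorem intervalIntegrable_log_sin_pi_mul :
    IntervalIntegrable (fun x => Real.log (Real.sin (Real.pi * x))) MeasureTheory.volume 0 1 := by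
  simpa [Real.pi_ne_zero] using
    (intervalIntegrable_log_sin (a := 0) (b := Real.pi)).comp_mul_left (c := Real.pi)

theorem integral_log_sin_pi_mul :
    ∫ x in (0:ℝ)..1, Real.log (Real.sin (Real.pi * x)) = -Real.log 2 := by
  rw [intervalIntegral.integral_comp_mul_left (fun y => Real.log (Real.sin y)) Real.pi_ne_zero,
    mul_zero, mul_one, integral_log_sin_zero_pi, smul_eq_mul]
  field_simp

theorem sin_pi_mul_pos {x : ℝ} (hx : x ∈ Set.Ioo (0:ℝ) 1) : 0 < Real.sin (Real.pi * x) :=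
  Real.sin_pos_of_pos_of_lt_pi (mul_pos Real.pi_pos hx.1)
    (mul_lt_of_lt_one_right Real.pi_pos hx.2)

theorem integral_cos_mul_log_sin {n : ℕ} (hn : n ≠ 0) :
    ∫ x in (0:ℝ)..1, Real.cos (2 * Real.pi * n * x) * Real.log (Real.sin (Real.pi * x)) =
      -1 / (2 * n) := by
  set D : ℝ → ℝ := fun x => ∑ k ∈ Finset.range n, 2 * Real.cos ((2 * k + 1) * (Real.pi * x))
    with hD
  have hDc : Continuous D := by fun_prop
  have hi1 : IntervalIntegrable (fun x => Real.cos (2 * Real.pi * n * x) *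
      Real.log (Real.sin (Real.pi * x))) MeasureTheory.volume 0 1 :=
    intervalIntegrable_log_sin_pi_mul.continuousOn_mul (by fun_prop)
  have hi2 : IntervalIntegrable (fun x => D x * Real.cos (Real.pi * x))
      MeasureTheory.volume 0 1 := (by fun_prop : Continuous _).intervalIntegrable _ _
  have hcont : Continuous fun x =>
      Real.sin (2 * Real.pi * n * x) * Real.log (Real.sin (Real.pi * x)) := by
    have : (fun x => Real.sin (2 * Real.pi * n * x) * Real.log (Real.sin (Real.pi * x))) =
        fun x => D x * (Real.sin (Real.pi * x) * Real.log (Real.sin (Real.pi * x))) := by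
      ext x
      rw [sin_two_pi_nat_mul_eq, hD]
      ring
    rw [this]
    exact hDc.mul (Real.continuous_mul_log.comp
      (by fun_prop : Continuous fun x => Real.sin (Real.pi * x)))
  have hderiv : ∀ x ∈ Set.Ioo (0:ℝ) 1, HasDerivAt
      (fun x => Real.sin (2 * Real.pi * n * x) * Real.log (Real.sin (Real.pi * x)))
      (2 * Real.pi * n * (Real.cos (2 * Real.pi * n * x) * Real.log (Real.sin (Real.pi * x))) +
        Real.pi * (D x * Real.cos (Real.pi * x))) x := by
    intro x hx
    have hs := (sin_pi_mul_pos hx).ne'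
    have h1 := ((hasDerivAt_id x).const_mul (2 * Real.pi * n)).sin
    have h2 := (((hasDerivAt_id x).const_mul Real.pi).sin).log hs
    refine (h1.mul h2).congr_deriv ?_
    simp only [id, sin_two_pi_nat_mul_eq, hD]
    field_simp
  have h := intervalIntegral.integral_eq_sub_of_hasDerivAt_of_le zero_le_one hcont.continuousOn
    hderiv ((hi1.const_mul _).add (hi2.const_mul _))
  rw [intervalIntegral.integral_add (hi1.const_mul _) (hi2.const_mul _),
    intervalIntegral.integral_const_mul, intervalIntegral.integral_const_mul,
    integral_sum_cos_odd_mul_cos hn] at h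
  simp only [mul_zero, mul_one, Real.sin_zero, Real.sin_pi, Real.log_zero, sub_self] at h
  have hn' : (n : ℝ) ≠ 0 := by exact_mod_cast hn
  rw [eq_div_iff (by positivity)]
  refine mul_left_cancel₀ Real.pi_ne_zero ?_
  linear_combination h

theorem hasSum_cos_div_sq {x : ℝ} (hx : x ∈ Set.Icc (0:ℝ) 1) :
    HasSum (fun n : ℕ => 1 / (n : ℝ) ^ 2 * Real.cos (2 * Real.pi * n * x))
      (Real.pi ^ 2 * (1 / 6 - (x - x ^ 2))) := by
  convert! hasSum_one_div_nat_pow_mul_cos one_ne_zero hx using 1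
  simp only [Polynomial.bernoulli, Finset.sum_range_succ, Finset.sum_range_zero, mul_one,
    Polynomial.map_add, Polynomial.map_monomial, Polynomial.eval_add, Polynomial.eval_monomial]
  simp [bernoulli_eq_bernoulli'_of_ne_one (by decide : 2 ≠ 1), Nat.factorial]
  ring

theorem hasSum_riemannZeta_three_re :
    HasSum (fun n : ℕ => 1 / (n : ℝ) ^ 3) (riemannZeta 3).re := by
  have h := zeta_nat_eq_tsum_of_gt_one (k := 3) (by norm_num)
  have hs : Summable fun n : ℕ => 1 / (n : ℝ) ^ 3 :=
    Real.summable_one_div_nat_pow.mpr (by norm_num)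
  have : riemannZeta 3 = ((∑' n : ℕ, 1 / (n : ℝ) ^ 3 : ℝ) : ℂ) := by
    push_cast
    exact_mod_cast h
  rw [this, Complex.ofReal_re]
  exact hs.hasSum

theorem integral_mul_log_sin_pi_mul :
    ∫ x in (0:ℝ)..1, (x - x ^ 2) * Real.log (Real.sin (Real.pi * x)) =
      -Real.log 2 / 6 + (riemannZeta 3).re / (2 * Real.pi ^ 2) := by
  have hL := intervalIntegrable_log_sin_pi_mul
  have hsum := intervalIntegral.hasSum_integral_of_dominated_convergence
    (μ := MeasureTheory.volume) (a := 0) (b := 1)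
    (F := fun (n : ℕ) x => 1 / (n : ℝ) ^ 2 *
      (Real.cos (2 * Real.pi * n * x) * Real.log (Real.sin (Real.pi * x))))
    (f := fun x => Real.pi ^ 2 * (1 / 6 - (x - x ^ 2)) * Real.log (Real.sin (Real.pi * x)))
    (fun n x => 1 / (n : ℝ) ^ 2 * |Real.log (Real.sin (Real.pi * x))|)
    (fun n => (((by fun_prop : Measurable _) : Measurable
      fun x : ℝ => 1 / (n : ℝ) ^ 2 * (Real.cos (2 * Real.pi * n * x) *
        Real.log (Real.sin (Real.pi * x))))).aestronglyMeasurable)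
    (fun n => .of_forall fun x _ => by
      rw [norm_mul, norm_mul, Real.norm_of_nonneg (by positivity)]
      gcongr
      exact mul_le_of_le_one_left (abs_nonneg _) (Real.abs_cos_le_one _))
    (.of_forall fun x _ => (Real.summable_one_div_nat_pow.mpr one_lt_two).mul_right _)
    (by
      simp_rw [tsum_mul_right]
      exact hL.abs.const_mul _)
    (.of_forall fun x hx => by
      rw [Set.uIoc_of_le zero_le_one] at hx
      simpa only [mul_assoc] using (hasSum_cos_div_sq ⟨hx.1.le, hx.2⟩).mul_right
        (Real.log (Real.sin (Real.pi * x))))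
  have hterm : (fun n : ℕ => ∫ x in (0:ℝ)..1, 1 / (n : ℝ) ^ 2 *
      (Real.cos (2 * Real.pi * n * x) * Real.log (Real.sin (Real.pi * x)))) =
      fun n : ℕ => 1 / (n : ℝ) ^ 3 * (-1 / 2) := by
    ext n
    rw [intervalIntegral.integral_const_mul]
    rcases eq_or_ne n 0 with rfl | hn
    · simp
    · rw [integral_cos_mul_log_sin hn]
      field_simp
  rw [hterm] at hsum
  have heq := hsum.unique (hasSum_riemannZeta_three_re.mul_right (-1 / 2))
  have hI : IntervalIntegrable (fun x => (x - x ^ 2) * Real.log (Real.sin (Real.pi * x)))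
      MeasureTheory.volume 0 1 := hL.continuousOn_mul (by fun_prop)
  have hsplit : ∀ x : ℝ, Real.pi ^ 2 * (1 / 6 - (x - x ^ 2)) * Real.log (Real.sin (Real.pi * x)) =
      Real.pi ^ 2 / 6 * Real.log (Real.sin (Real.pi * x)) -
        Real.pi ^ 2 * ((x - x ^ 2) * Real.log (Real.sin (Real.pi * x))) := fun x => by ring
  simp_rw [hsplit] at heq
  rw [intervalIntegral.integral_sub (hL.const_mul _) (hI.const_mul _),
    intervalIntegral.integral_const_mul, intervalIntegral.integral_const_mul,
    integral_log_sin_pi_mul] at heq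
  generalize (∫ x in (0:ℝ)..1, (x - x ^ 2) * Real.log (Real.sin (Real.pi * x))) = J at heq ⊢
  have hpi := Real.pi_ne_zero
  field_simp
  linear_combination -12 * heq

theorem intervalIntegrable_mul_log_Gamma :
    IntervalIntegrable (fun x => (x - x ^ 2) * Real.log (Real.Gamma x))
      MeasureTheory.volume 0 1 := by
  have hc : ContinuousOn (fun x => (x - x ^ 2) * Real.log (Real.Gamma (x + 1)) -
      (1 - x) * (x * Real.log x)) (Set.uIcc 0 1) := by
    rw [Set.uIcc_of_le zero_le_one]
    refine ContinuousOn.sub (ContinuousOn.mul (by fun_prop) fun x hx => ?_)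
      (ContinuousOn.mul (by fun_prop) Real.continuous_mul_log.continuousOn)
    have hx1 : 0 < x + 1 := by linarith [hx.1]
    have hG : ContinuousAt Real.Gamma (x + 1) :=
      (Real.differentiableAt_Gamma fun m => by
        have : (0:ℝ) ≤ m := m.cast_nonneg
        linarith).continuousAt
    exact ((ContinuousAt.comp (f := fun y : ℝ => y + 1) hG (by fun_prop)).log
      (Real.Gamma_pos_of_pos hx1).ne').continuousWithinAt
  refine hc.intervalIntegrable.congr fun x hx => ?_
  rw [Set.uIoc_of_le zero_le_one] at hx
  rw [Real.Gamma_add_one hx.1.ne', Real.log_mul hx.1.ne' (Real.Gamma_pos_of_pos hx.1).ne']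
  ring

theorem log_Gamma_add_log_Gamma_one_sub {x : ℝ} (hx : x ∈ Set.Ioo (0:ℝ) 1) :
    Real.log (Real.Gamma x) + Real.log (Real.Gamma (1 - x)) =
      Real.log Real.pi - Real.log (Real.sin (Real.pi * x)) := by
  rw [← Real.log_mul (Real.Gamma_pos_of_pos hx.1).ne'
    (Real.Gamma_pos_of_pos (sub_pos.mpr hx.2)).ne', Real.Gamma_mul_Gamma_one_sub,
    Real.log_div Real.pi_ne_zero (sin_pi_mul_pos hx).ne']

theorem stmt_19 :
    ∫ x in (0:ℝ)..1, (x - x ^ 2) * Real.log (Real.Gamma x) =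
      (1/12) * Real.log (2 * Real.pi) - (riemannZeta 3).re / (4 * Real.pi ^ 2) := by
  have hg := intervalIntegrable_mul_log_Gamma
  have hg' : IntervalIntegrable (fun x => ((1 - x) - (1 - x) ^ 2) * Real.log (Real.Gamma (1 - x)))
      MeasureTheory.volume 0 1 := by
    simpa using (hg.comp_sub_left 1).symm
  have hI : IntervalIntegrable (fun x => (x - x ^ 2) * Real.log (Real.sin (Real.pi * x)))
      MeasureTheory.volume 0 1 :=
    intervalIntegrable_log_sin_pi_mul.continuousOn_mul (by fun_prop)
  have hP : IntervalIntegrable (fun x : ℝ => (x - x ^ 2) * Real.log Real.pi)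
      MeasureTheory.volume 0 1 := (by fun_prop : Continuous _).intervalIntegrable _ _
  have hrefl : ∫ x in (0:ℝ)..1, ((1 - x) - (1 - x) ^ 2) * Real.log (Real.Gamma (1 - x)) =
      ∫ x in (0:ℝ)..1, (x - x ^ 2) * Real.log (Real.Gamma x) := by
    simpa using intervalIntegral.integral_comp_sub_left (a := 0) (b := 1)
      (fun x => (x - x ^ 2) * Real.log (Real.Gamma x)) 1
  have hsum : (∫ x in (0:ℝ)..1, ((x - x ^ 2) * Real.log (Real.Gamma x) +
      ((1 - x) - (1 - x) ^ 2) * Real.log (Real.Gamma (1 - x)))) =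
      ∫ x in (0:ℝ)..1, ((x - x ^ 2) * Real.log Real.pi -
        (x - x ^ 2) * Real.log (Real.sin (Real.pi * x))) := by
    refine intervalIntegral.integral_congr_Ioo_of_le zero_le_one fun x hx => ?_
    linear_combination (x - x ^ 2) * log_Gamma_add_log_Gamma_one_sub hx
  have hpoly : ∫ x in (0:ℝ)..1, (x - x ^ 2) = 1 / 6 := by
    rw [intervalIntegral.integral_sub (by simp) (by simp)]
    norm_num
  rw [intervalIntegral.integral_add hg hg', hrefl, intervalIntegral.integral_sub hP hI,
    intervalIntegral.integral_mul_const, hpoly, integral_mul_log_sin_pi_mul] at hsum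
  rw [Real.log_mul two_ne_zero Real.pi_ne_zero]
  have hpi := Real.pi_ne_zero
  field_simp at hsum ⊢
  linear_combination 2 * hsum
end
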